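/- There exists a universal constant C > 0 such that the following holds. Let the number of agents n = p^ν be a power of a prime with n ≥ 2, let M be a finite set, and let v_1, …, v_n : 2^M → ℝ be arbitrary valuation functions with marginals bounded by 1. Then there exists an allocation A = (A_1, …, A_n) of M and a payment vector p ≥ 0 such that (A, p) is envy-free and the total subsidy satisfies ∑_{i=1}^n p_i ≤ C·n·√(n·log n). -/

import Mathlib

namespace EnvyFreeSubsidy

section Chains

variable (R : Type*) [CommRing R] {V W G : Type*}

/-- Formal `R`-linear combinations of finite sequences of points of `W`, the augmented ordered
simplicial chains on the vertex set `W`. -/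
abbrev Chain (W : Type*) := List W →₀ R

/-- Prepend a vertex to every simplex of a chain. -/
noncomputable def cons (a : W) : Chain R W →ₗ[R] Chain R W :=
  Finsupp.lmapDomain R R (List.cons a)

/-- The chain map induced by a map of vertices. -/
noncomputable def push (f : V → W) : Chain R V →ₗ[R] Chain R W :=
  Finsupp.lmapDomain R R (List.map f)

/-- The boundary of a simplex. -/
noncomputable def bdList : List W → Chain R W
  | [] => 0
  | a :: l => Finsupp.single l 1 - cons R a (bdList l)

/-- The boundary operator. -/
noncomputable def bd : Chain R W →ₗ[R] Chain R W :=
  Finsupp.linearCombination R (bdList R)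

/-- The prism over a simplex, between its images under two vertex maps. -/
noncomputable def prismList (f f' : V → W) : List V → Chain R W
  | [] => 0
  | a :: l => Finsupp.single (f a :: f' a :: l.map f') 1 - cons R (f a) (prismList f f' l)

/-- The prism operator, a chain homotopy between two maps of vertices. -/
noncomputable def prism (f f' : V → W) : Chain R V →ₗ[R] Chain R W :=
  Finsupp.linearCombination R (prismList R f f')

variable {R}

@[simp] lemma cons_single (a : W) (l : List W) (r : R) :
    cons R a (Finsupp.single l r) = Finsupp.single (a :: l) r := by
  simp [cons]

@[simp] lemma push_single (f : V → W) (l : List V) (r : R) :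
    push R f (Finsupp.single l r) = Finsupp.single (l.map f) r := by
  simp [push]

@[simp] lemma bd_single (l : List W) : bd R (Finsupp.single l 1) = bdList R l := by
  simp [bd]

@[simp] lemma prism_single (f f' : V → W) (l : List V) :
    prism R f f' (Finsupp.single l 1) = prismList R f f' l := by
  simp [prism]

lemma hom_ext {M : Type*} [AddCommGroup M] [Module R M] {φ ψ : Chain R W →ₗ[R] M}
    (h : ∀ l, φ (Finsupp.single l 1) = ψ (Finsupp.single l 1)) : φ = ψ :=
  Finsupp.lhom_ext' fun l => LinearMap.ext_ring (by simpa using h l)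

lemma bd_cons (a : W) (x : Chain R W) : bd R (cons R a x) = x - cons R a (bd R x) := by
  have : bd R ∘ₗ cons R a = LinearMap.id - cons R a ∘ₗ bd R :=
    hom_ext fun l => by simp [bdList]
  exact LinearMap.congr_fun this x

lemma push_cons (f : V → W) (a : V) (x : Chain R V) :
    push R f (cons R a x) = cons R (f a) (push R f x) := by
  have : push R f ∘ₗ cons R a = cons R (f a) ∘ₗ push R f := hom_ext fun l => by simp
  exact LinearMap.congr_fun this x

lemma prism_cons (f f' : V → W) (a : V) (x : Chain R V) :
    prism R f f' (cons R a x) =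
      cons R (f a) (cons R (f' a) (push R f' x)) - cons R (f a) (prism R f f' x) := by
  have : prism R f f' ∘ₗ cons R a =
      cons R (f a) ∘ₗ cons R (f' a) ∘ₗ push R f' - cons R (f a) ∘ₗ prism R f f' :=
    hom_ext fun l => by simp [prismList]
  exact LinearMap.congr_fun this x

lemma bd_push (f : V → W) (x : Chain R V) : bd R (push R f x) = push R f (bd R x) := by
  have : bd R ∘ₗ push R f = push R f ∘ₗ bd R := hom_ext fun l => by
    induction l with
    | nil => simp [bdList]
    | cons a l ih =>
      simp only [LinearMap.comp_apply, push_single, bd_single] at ih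
      simp [bdList, ih, push_cons]
  exact LinearMap.congr_fun this x

lemma push_push {U : Type*} (f : V → W) (g : U → V) (x : Chain R U) :
    push R f (push R g x) = push R (f ∘ g) x := by
  have : push R f ∘ₗ push R g = push R (f ∘ g) := hom_ext fun l => by simp
  exact LinearMap.congr_fun this x

lemma bd_prism (f f' : V → W) (x : Chain R V) :
    bd R (prism R f f' x) = push R f' x - push R f x - prism R f f' (bd R x) := by
  have : bd R ∘ₗ prism R f f' = push R f' - push R f - prism R f f' ∘ₗ bd R :=
    hom_ext fun l => by
      induction l with
      | nil => simp [bdList, prismList]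
      | cons a l ih =>
        simp only [LinearMap.comp_apply, LinearMap.sub_apply, push_single, bd_single,
          prism_single] at ih
        have h := bd_push (R := R) f' (Finsupp.single l 1)
        simp only [push_single, bd_single] at h
        simp only [LinearMap.comp_apply, LinearMap.sub_apply, push_single, bd_single,
          prism_single, prismList, bdList, map_sub, bd_cons, ih, prism_cons, h,
          cons_single, List.map_cons]
        abel
  exact LinearMap.congr_fun this x

lemma push_prism {U X : Type*} (f f' : V → W) (g g' : U → X) (h : W → X) (k : V → U)
    (e : h ∘ f = g ∘ k) (e' : h ∘ f' = g' ∘ k) (x : Chain R V) :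
    push R h (prism R f f' x) = prism R g g' (push R k x) := by
  have : push R h ∘ₗ prism R f f' = prism R g g' ∘ₗ push R k := hom_ext fun l => by
    induction l with
    | nil => simp [prismList]
    | cons a l ih =>
      have ea : h (f a) = g (k a) := congrFun e a
      have ea' : h (f' a) = g' (k a) := congrFun e' a
      simp only [LinearMap.comp_apply, push_single, prism_single] at ih
      simp [prismList, push_cons, ih, ea, ea', e']
  exact LinearMap.congr_fun this x

lemma prismList_mem_supported (f f' : V → W) (l : List V) :
    prismList R f f' l ∈ Finsupp.supported R R
      {l' | l'.length = l.length + 1 ∧ ∀ w ∈ l', ∃ a ∈ l, w = f a ∨ w = f' a} := by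
  induction l with
  | nil => simp [prismList]
  | cons a l ih =>
    refine Submodule.sub_mem _ ?_ ?_
    · refine Finsupp.single_mem_supported R 1 ⟨by simp, ?_⟩
      simp only [List.mem_cons, List.mem_map]
      rintro w (rfl | rfl | ⟨b, hb, rfl⟩)
      · exact ⟨a, by simp⟩
      · exact ⟨a, by simp⟩
      · exact ⟨b, by simp [hb]⟩
    · have := Submodule.mem_map_of_mem (f := cons R (f a)) ih
      rw [cons, Finsupp.lmapDomain_supported] at this
      refine Finsupp.supported_mono ?_ this
      rintro _ ⟨l', ⟨h1, h2⟩, rfl⟩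
      refine ⟨by simp [h1], ?_⟩
      simp only [List.mem_cons]
      rintro w (rfl | hw)
      · exact ⟨a, by simp⟩
      · obtain ⟨b, hb, h⟩ := h2 w hw
        exact ⟨b, by simp [hb], h⟩

/-! ### Chain maps built from contractions -/

/-- The chain map from chains on `G` sending `g :: l` to `K g` applied to the image of `l`. -/
noncomputable def coneList (K : G → Chain R W →ₗ[R] Chain R W) : List G → Chain R W
  | [] => Finsupp.single [] 1
  | g :: l => K g (coneList K l)

/-- Linear extension of `coneList`. -/
noncomputable def coneMap (K : G → Chain R W →ₗ[R] Chain R W) : Chain R G →ₗ[R] Chain R W :=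
  Finsupp.linearCombination R (coneList K)

/-- The chain homotopy between `coneMap K` and `coneMap J`, on simplices. -/
noncomputable def homotopyList (K J : G → Chain R W →ₗ[R] Chain R W) : List G → Chain R W
  | [] => 0
  | g :: l => J g (K g (coneList K l)) - J g (homotopyList K J l)

/-- Linear extension of `homotopyList`. -/
noncomputable def homotopyMap (K J : G → Chain R W →ₗ[R] Chain R W) :
    Chain R G →ₗ[R] Chain R W :=
  Finsupp.linearCombination R (homotopyList K J)

@[simp] lemma coneMap_single (K : G → Chain R W →ₗ[R] Chain R W) (l : List G) :
    coneMap K (Finsupp.single l 1) = coneList K l := by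
  simp [coneMap]

@[simp] lemma homotopyMap_single (K J : G → Chain R W →ₗ[R] Chain R W) (l : List G) :
    homotopyMap K J (Finsupp.single l 1) = homotopyList K J l := by
  simp [homotopyMap]

lemma coneMap_cons (K : G → Chain R W →ₗ[R] Chain R W) (g : G) (x : Chain R G) :
    coneMap K (cons R g x) = K g (coneMap K x) := by
  have : coneMap K ∘ₗ cons R g = K g ∘ₗ coneMap K := hom_ext fun l => by simp [coneList]
  exact LinearMap.congr_fun this x

lemma homotopyMap_cons (K J : G → Chain R W →ₗ[R] Chain R W) (g : G) (x : Chain R G) :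
    homotopyMap K J (cons R g x) = J g (K g (coneMap K x)) - J g (homotopyMap K J x) := by
  have : homotopyMap K J ∘ₗ cons R g = J g ∘ₗ K g ∘ₗ coneMap K - J g ∘ₗ homotopyMap K J :=
    hom_ext fun l => by simp [homotopyList]
  exact LinearMap.congr_fun this x

lemma bd_coneMap {K : G → Chain R W →ₗ[R] Chain R W}
    (hK : ∀ g x, bd R (K g x) = x - K g (bd R x)) (x : Chain R G) :
    bd R (coneMap K x) = coneMap K (bd R x) := by
  have : bd R ∘ₗ coneMap K = coneMap K ∘ₗ bd R := hom_ext fun l => by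
    induction l with
    | nil => simp [coneList, bdList]
    | cons a l ih =>
      simp only [LinearMap.comp_apply, coneMap_single, bd_single] at ih
      simp [coneList, bdList, hK, ih, coneMap_cons]
  exact LinearMap.congr_fun this x

lemma bd_homotopyMap {K J : G → Chain R W →ₗ[R] Chain R W}
    (hK : ∀ g x, bd R (K g x) = x - K g (bd R x))
    (hJ : ∀ g x, bd R (J g x) = x - J g (bd R x)) (x : Chain R G) :
    bd R (homotopyMap K J x) = coneMap K x - coneMap J x - homotopyMap K J (bd R x) := by
  have : bd R ∘ₗ homotopyMap K J =
      coneMap K - coneMap J - homotopyMap K J ∘ₗ bd R := hom_ext fun l => by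
    induction l with
    | nil => simp [coneList, bdList, homotopyList]
    | cons a l ih =>
      simp only [LinearMap.comp_apply, LinearMap.sub_apply, coneMap_single, homotopyMap_single,
        bd_single] at ih
      have h := bd_coneMap hK (Finsupp.single l 1)
      simp only [coneMap_single, bd_single] at h
      simp only [LinearMap.comp_apply, LinearMap.sub_apply, coneMap_single, homotopyMap_single,
        bd_single, homotopyList, coneList, bdList, map_sub, hJ, hK, ih, h, homotopyMap_cons]
      abel
  exact LinearMap.congr_fun this x

lemma push_coneMap {K : G → Chain R W →ₗ[R] Chain R W} {σ : G → G} {τ : W → W}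
    (hK : ∀ g x, push R τ (K g x) = K (σ g) (push R τ x)) (x : Chain R G) :
    push R τ (coneMap K x) = coneMap K (push R σ x) := by
  have : push R τ ∘ₗ coneMap K = coneMap K ∘ₗ push R σ := hom_ext fun l => by
    induction l with
    | nil => simp [coneList]
    | cons a l ih =>
      simp only [LinearMap.comp_apply, coneMap_single, push_single] at ih
      simp [coneList, hK, ih]
  exact LinearMap.congr_fun this x

lemma push_homotopyMap {K J : G → Chain R W →ₗ[R] Chain R W} {σ : G → G} {τ : W → W}
    (hK : ∀ g x, push R τ (K g x) = K (σ g) (push R τ x))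
    (hJ : ∀ g x, push R τ (J g x) = J (σ g) (push R τ x)) (x : Chain R G) :
    push R τ (homotopyMap K J x) = homotopyMap K J (push R σ x) := by
  have : push R τ ∘ₗ homotopyMap K J = homotopyMap K J ∘ₗ push R σ := hom_ext fun l => by
    induction l with
    | nil => simp [homotopyList]
    | cons a l ih =>
      have h := push_coneMap hK (Finsupp.single l 1)
      simp only [LinearMap.comp_apply, coneMap_single, homotopyMap_single, push_single] at ih h
      simp [homotopyList, hK, hJ, ih, h]
  exact LinearMap.congr_fun this x

lemma coneMap_cons_eq_push (ι : G → W) (x : Chain R G) :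
    coneMap (fun g => cons R (ι g)) x = push R ι x := by
  have : coneMap (fun g => cons R (ι g)) = push R ι := hom_ext fun l => by
    induction l with
    | nil => simp [coneList]
    | cons a l ih =>
      simp only [coneMap_single, push_single] at ih
      simp [coneList, ih]
  exact LinearMap.congr_fun this x

/-! ### Iterated cup products of 2-cochains -/

/-- The cup product of a list of 2-cochains, evaluated on a simplex. -/
def cupList : List (W → W → W → R) → List W → R
  | [], [_] => 1
  | y :: ys, a :: b :: c :: l => y a b c * cupList ys (c :: l)
  | _, _ => 0

/-- The cup product of a list of 2-cochains, as a functional on chains. -/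
noncomputable def cup (ys : List (W → W → W → R)) : Chain R W →ₗ[R] R :=
  Finsupp.linearCombination R (cupList ys)

@[simp] lemma cup_single (ys : List (W → W → W → R)) (l : List W) :
    cup ys (Finsupp.single l 1) = cupList ys l := by
  simp [cup]

lemma cup_nil_cons_cons (a b : W) (x : Chain R W) :
    cup (R := R) [] (cons R a (cons R b x)) = 0 := by
  have : cup (R := R) [] ∘ₗ cons R a ∘ₗ cons R b = 0 := hom_ext fun l => by simp [cupList]
  exact LinearMap.congr_fun this x

lemma cup_cons_cons (y : W → W → W → R) (ys : List (W → W → W → R)) (a b c : W)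
    (x : Chain R W) :
    cup (y :: ys) (cons R a (cons R b (cons R c x))) = y a b c * cup ys (cons R c x) := by
  have : cup (y :: ys) ∘ₗ cons R a ∘ₗ cons R b ∘ₗ cons R c = y a b c • (cup ys ∘ₗ cons R c) :=
    hom_ext fun l => by simp [cupList]
  exact LinearMap.congr_fun this x

lemma cup_bd (ys : List (W → W → W → R))
    (hy : ∀ y ∈ ys, ∀ a b c d, y b c d - y a c d + y a b d - y a b c = 0) (x : Chain R W) :
    cup ys (bd R x) = 0 := by
  induction ys generalizing x with
  | nil =>
    have : cup (R := R) [] ∘ₗ bd R = (0 : Chain R W →ₗ[R] R) := hom_ext fun l => by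
      match l with
      | [] => simp [bdList]
      | [a] => simp [bdList, cupList]
      | [a, b] => simp [bdList, cupList]
      | a :: b :: c :: l =>
        simp [bdList, cupList, cup_nil_cons_cons]
    exact LinearMap.congr_fun this x
  | cons y ys ih =>
    have ih := ih fun y' h => hy y' (List.mem_cons_of_mem _ h)
    have hy := hy y List.mem_cons_self
    have : cup (y :: ys) ∘ₗ bd R = 0 := hom_ext fun l => by
      match l with
      | [] => simp [bdList]
      | [a] => simp [bdList, cupList]
      | [a, b] => simp [bdList, cupList]
      | [a, b, c] => simp [bdList, cupList]
      | a :: b :: c :: d :: l =>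
        have h := ih (cons R c (Finsupp.single (d :: l) 1))
        rw [bd_cons, map_sub, sub_eq_zero, cup_single, bd_single] at h
        have e : bdList R (a :: b :: c :: d :: l) = Finsupp.single (b :: c :: d :: l) 1
            - Finsupp.single (a :: c :: d :: l) 1 + Finsupp.single (a :: b :: d :: l) 1
            - cons R a (cons R b (cons R c (bdList R (d :: l)))) := by
          simp only [bdList, map_sub, cons_single]
          abel
        simp only [LinearMap.comp_apply, bd_single, e, map_sub, map_add, cup_single, cupList,
          cup_cons_cons, ← h, LinearMap.zero_apply]
        linear_combination cupList ys (d :: l) * hy a b c d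
    exact LinearMap.congr_fun this x

lemma cup_push (ys : List (W → W → W → R)) (f : V → W) (x : Chain R V) :
    cup ys (push R f x) = cup (ys.map fun y a b c => y (f a) (f b) (f c)) x := by
  have : cup ys ∘ₗ push R f = cup (ys.map fun y a b c => y (f a) (f b) (f c)) :=
    hom_ext fun l => by
      simp only [LinearMap.comp_apply, push_single, cup_single]
      induction ys generalizing l with
      | nil =>
        match l with
        | [] => simp [cupList]
        | [a] => simp [cupList]
        | a :: b :: l => simp [cupList]
      | cons y ys ih =>
        match l with
        | [] => simp [cupList]
        | [a] => simp [cupList]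
        | [a, b] => simp [cupList]
        | a :: b :: c :: l => simp [cupList, ← ih]
  exact LinearMap.congr_fun this x

lemma cupList_ne_zero {ys : List (W → W → W → R)} {l : List W} (h : cupList ys l ≠ 0) :
    l.length = 2 * ys.length + 1 ∧
      ∀ y ∈ ys, ∃ a ∈ l, ∃ b ∈ l, ∃ c ∈ l, y a b c ≠ 0 := by
  induction ys generalizing l with
  | nil =>
    match l with
    | [] => simp [cupList] at h
    | [a] => simp
    | a :: b :: l => simp [cupList] at h
  | cons y ys ih =>
    match l with
    | [] => simp [cupList] at h
    | [a] => simp [cupList] at h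
    | [a, b] => simp [cupList] at h
    | a :: b :: c :: l =>
      rw [cupList] at h
      obtain ⟨h1, h2⟩ := ih (right_ne_zero_of_mul h)
      have hy := left_ne_zero_of_mul h
      refine ⟨by simp at h1 ⊢; omega, ?_⟩
      simp only [List.mem_cons, forall_eq_or_imp]
      refine ⟨⟨a, by simp, b, by simp, c, by simp, hy⟩, fun y' hy' => ?_⟩
      obtain ⟨a', ha, b', hb, c', hc, h'⟩ := h2 y' hy'
      simp only [List.mem_cons] at ha hb hc
      exact ⟨a', by tauto, b', by tauto, c', by tauto, h'⟩

end Chains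

section Contraction

variable {R : Type*} [CommRing R] {G : Type*}

/-- Replace the first `t` letters of the word `w` by `g`. -/
def sweep (g : G) (t : ℕ) (w : ℕ → G) : ℕ → G := fun s => if s < t then g else w s

variable (R) in
/-- The contraction of the complex of chains on words that sweeps the first `N` letters to `g`,
one letter at a time, and then cones off with the constant word `g`. -/
noncomputable def contraction (N : ℕ) (g : G) : Chain R (ℕ → G) →ₗ[R] Chain R (ℕ → G) :=
  ∑ t ∈ Finset.range N, prism R (sweep g (t + 1)) (sweep g t) +
    cons R (fun _ => g) ∘ₗ push R (sweep g N)

lemma push_id {W : Type*} (x : Chain R W) : push R id x = x := by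
  have : push R (id : W → W) = LinearMap.id := hom_ext fun l => by simp
  exact LinearMap.congr_fun this x

lemma bd_contraction (N : ℕ) (g : G) (x : Chain R (ℕ → G)) :
    bd R (contraction R N g x) = x - contraction R N g (bd R x) := by
  have h0 : sweep g 0 = id := by ext w s; simp [sweep]
  have h := Finset.sum_range_sub' (fun t => push R (sweep g t) x) N
  simp only [h0, push_id, Finset.sum_sub_distrib] at h
  simp only [contraction, LinearMap.add_apply, LinearMap.sum_apply, map_add, map_sum, bd_prism,
    LinearMap.comp_apply, bd_cons, bd_push, Finset.sum_sub_distrib, h]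
  abel

lemma push_contraction [AddGroup G] (N : ℕ) (g h : G) (x : Chain R (ℕ → G)) :
    push R (fun w s => h + w s) (contraction R N g x) =
      contraction R N (h + g) (push R (fun w s => h + w s) x) := by
  have key (t : ℕ) : (fun (w : ℕ → G) s => h + w s) ∘ sweep g t =
      sweep (h + g) t ∘ fun w s => h + w s := by
    ext w s
    simp only [Function.comp, sweep]
    split <;> rfl
  simp only [contraction, LinearMap.add_apply, LinearMap.sum_apply, map_add, map_sum,
    LinearMap.comp_apply, push_cons, push_push, key]
  congr 1
  exact Finset.sum_congr rfl fun t _ => push_prism _ _ _ _ _ _ (key _) (key _) x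

variable [DecidableEq G]

/-- The blocks of length `L`, among the first `m`, on which the word `w` is not constant. -/
def mixedBlocks (m L : ℕ) (w : ℕ → G) : Finset ℕ :=
  {a ∈ Finset.range m | ∃ r < L, w (a * L + r) ≠ w (a * L)}

/-- A sequence of words is fine if its words differ in few letters and have few mixed blocks. -/
def IsFine (m L : ℕ) (l : List (ℕ → G)) : Prop :=
  (∃ T : Finset ℕ, T.card ≤ l.length ∧
    ∀ w ∈ l, ∀ w' ∈ l, ∀ s < m * L, s ∉ T → w s = w' s) ∧
  ∀ w ∈ l, (mixedBlocks m L w).card ≤ l.length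

lemma mixedBlocks_sweep_subset {m L : ℕ} {t t' : ℕ} (ht : t' = t ∨ t' = t + 1) (g : G)
    (w : ℕ → G) : mixedBlocks m L (sweep g t' w) ⊆ insert (t / L) (mixedBlocks m L w) := by
  intro a ha
  simp only [mixedBlocks, Finset.mem_filter, Finset.mem_range, Finset.mem_insert] at ha ⊢
  obtain ⟨ham, r, hr, hne⟩ := ha
  by_contra! hcon
  obtain ⟨hat, hw⟩ := hcon
  have hw := hw ham r hr
  simp only [sweep] at hne
  have : t < a * L ∨ a * L + L ≤ t := by
    by_contra! hc
    apply hat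
    symm
    rw [Nat.div_eq_iff (by omega)]
    omega
  split_ifs at hne <;> first | omega | exact hne rfl | exact hne hw

lemma contraction_mem_supported {m L : ℕ} (g : G) {x : Chain R (ℕ → G)}
    (hx : x ∈ Finsupp.supported R R {l | IsFine m L l}) :
    contraction R (m * L) g x ∈ Finsupp.supported R R {l | IsFine m L l} := by
  suffices h : ∀ l : List (ℕ → G), IsFine m L l →
      contraction R (m * L) g (Finsupp.single l 1) ∈ Finsupp.supported R R {l | IsFine m L l} by
    rw [Finsupp.supported_eq_span_single] at hx
    refine Submodule.span_induction ?_ (by simp) (fun x y _ _ hx hy => ?_)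
      (fun a x _ hx => ?_) hx
    · rintro _ ⟨l, hl, rfl⟩
      exact h l hl
    · rw [map_add]
      exact Submodule.add_mem _ hx hy
    · rw [map_smul]
      exact Submodule.smul_mem _ a hx
  rintro l ⟨⟨T, hT, hl⟩, hmix⟩
  simp only [contraction, LinearMap.add_apply, LinearMap.sum_apply, prism_single,
    LinearMap.comp_apply, push_single, cons_single]
  refine Submodule.add_mem _ (Submodule.sum_mem _ fun t _ => ?_) ?_
  · refine Finsupp.supported_mono ?_ (prismList_mem_supported _ _ l)
    rintro l' ⟨hlen, hl'⟩
    refine ⟨⟨insert t T, (Finset.card_insert_le _ _).trans (by omega), ?_⟩, ?_⟩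
    · intro w hw w' hw' s hs hsT
      simp only [Finset.mem_insert, not_or] at hsT
      obtain ⟨a, ha, hwa⟩ := hl' w hw
      obtain ⟨a', ha', hwa'⟩ := hl' w' hw'
      have haa := hl a ha a' ha' s hs hsT.2
      have hst := hsT.1
      have e (t' : ℕ) (h : t' = t ∨ t' = t + 1) (b : ℕ → G) :
          sweep g t' b s = if s < t then g else b s := by
        simp only [sweep]
        refine if_congr ?_ rfl rfl
        omega
      rcases hwa with rfl | rfl <;> rcases hwa' with rfl | rfl <;> simp [e, haa]
    · intro w hw
      obtain ⟨a, ha, hwa⟩ := hl' w hw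
      have : mixedBlocks m L w ⊆ insert (t / L) (mixedBlocks m L a) := by
        rcases hwa with rfl | rfl
        · exact mixedBlocks_sweep_subset (Or.inr rfl) g a
        · exact mixedBlocks_sweep_subset (Or.inl rfl) g a
      have h1 := (Finset.card_le_card this).trans (Finset.card_insert_le _ _)
      have h2 := hmix a ha
      omega
  · refine Finsupp.single_mem_supported R 1 ?_
    have key : ∀ w ∈ (fun _ => g) :: l.map (sweep g (m * L)), ∀ s < m * L, w s = g := by
      simp only [List.mem_cons, List.mem_map]
      rintro w (rfl | ⟨b, -, rfl⟩) s hs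
      · rfl
      · simp [sweep, hs]
    refine ⟨⟨∅, by simp, fun w hw w' hw' s hs _ => by rw [key w hw s hs, key w' hw' s hs]⟩,
      fun w hw => ?_⟩
    have : mixedBlocks m L w = ∅ := by
      rw [mixedBlocks, Finset.filter_eq_empty_iff]
      rintro a ha ⟨r, hr, hne⟩
      rw [Finset.mem_range] at ha
      have : a * L + L ≤ m * L := by nlinarith
      exact hne (by rw [key w hw _ (by omega), key w hw _ (by omega)])
    simp [this]

lemma coneMap_contraction_mem_supported (m L : ℕ) (x : Chain R G) :
    coneMap (contraction R (m * L)) x ∈ Finsupp.supported R R {l | IsFine m L l} := by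
  rw [coneMap, Finsupp.linearCombination_apply]
  refine Submodule.sum_mem _ fun l hl => Submodule.smul_mem _ _ ?_
  clear hl
  induction l with
  | nil => exact Finsupp.single_mem_supported R 1 ⟨⟨∅, by simp⟩, by simp⟩
  | cons g l ih => exact contraction_mem_supported g ih

end Contraction

section GroupAlgebra

variable {R : Type*} [CommRing R] {G : Type*}

/-- The linear functional on the group algebra determined by a function on the group. -/
noncomputable def pair (f : G → R) : AddMonoidAlgebra R G →ₗ[R] R :=
  Finsupp.linearCombination R f ∘ₗ (AddMonoidAlgebra.coeffLinearEquiv R).toLinearMap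

@[simp] lemma pair_single (f : G → R) (u : G) (r : R) :
    pair f (AddMonoidAlgebra.single u r) = r * f u := by
  simp [pair, AddMonoidAlgebra.coeffLinearEquiv]

variable [AddCommGroup G]

/-- The action of the group algebra of `G` on chains with vertices in `G`. -/
noncomputable def act : AddMonoidAlgebra R G →ₐ[R] Module.End R (Chain R G) :=
  AddMonoidAlgebra.lift R (Module.End R (Chain R G)) G
    { toFun := fun u => push R (u.toAdd + ·)
      map_one' := by
        have : ((1 : Multiplicative G).toAdd + ·) = (id : G → G) := by ext; simp
        rw [this]
        exact LinearMap.ext push_id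
      map_mul' := fun u v => by
        refine LinearMap.ext fun x => ?_
        rw [Module.End.mul_apply, push_push]
        congr 2
        ext w
        simp [add_assoc] }

@[simp] lemma act_single (u : G) (r : R) (x : Chain R G) :
    act (AddMonoidAlgebra.single u r) x = r • push R (u + ·) x := by
  simp [act, AddMonoidAlgebra.lift_single]

lemma bd_act (b : AddMonoidAlgebra R G) (x : Chain R G) : bd R (act b x) = act b (bd R x) := by
  induction b using AddMonoidAlgebra.induction_linear with
  | zero => simp
  | add b c hb hc => simp [hb, hc]
  | single u r => simp [bd_push]

lemma act_mul (b c : AddMonoidAlgebra R G) (x : Chain R G) :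
    act (b * c) x = act b (act c x) := by
  rw [map_mul, Module.End.mul_apply]

lemma pair_one (f : G → R) : pair f 1 = f 0 := by
  rw [AddMonoidAlgebra.one_def, pair_single, one_mul]

lemma pair_mapDomain {H : Type*} [AddCommGroup H] (χ : G →+ H) (f : H → R)
    (b : AddMonoidAlgebra R G) :
    pair f (AddMonoidAlgebra.mapDomainAlgHom R R χ b) = pair (fun u => f (χ u)) b := by
  induction b using AddMonoidAlgebra.induction_linear with
  | zero => simp
  | add b c hb hc => rw [map_add, map_add, map_add, hb, hc]
  | single u r => simp

lemma cup_act {y : G → G → G → R} {ys : List (G → G → G → R)}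
    (hys : ∀ z ∈ ys, ∀ h a b c, z (h + a) (h + b) (h + c) = z a b c)
    (b c : AddMonoidAlgebra R G) (x : Chain R G) :
    cup (y :: ys) (cons R 0 (act b (cons R 0 (act c (cons R 0 x))))) =
      pair (fun u => pair (fun v => y 0 u (u + v)) c) b * cup ys (cons R 0 x) := by
  induction b using AddMonoidAlgebra.induction_linear with
  | zero => simp
  | add b b' hb hb' => simp [hb, hb', add_mul]
  | single u r =>
    induction c using AddMonoidAlgebra.induction_linear with
    | zero => simp [pair]
    | add c c' hc hc' =>
      simp only [pair_single] at hc hc' ⊢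
      simp only [map_add, LinearMap.add_apply, hc, hc']
      ring
    | single v s =>
      have h : cup ys (push R (u + ·) (push R (v + ·) (cons R 0 x))) = cup ys (cons R 0 x) := by
        rw [cup_push, cup_push]
        congr 1
        rw [List.map_map]
        conv_rhs => rw [← List.map_id ys]
        refine congrArg cup (List.map_congr_left fun z hz => ?_)
        ext a b c
        simp [hys z hz]
      have e : push R (u + ·) (push R (v + ·) (cons R 0 x)) =
          cons R (u + v) (push R (u + ·) (push R (v + ·) x)) := by
        simp [push_cons]
      simp only [act_single, map_smul, push_cons, cup_cons_cons, smul_eq_mul, pair_single,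
        add_zero]
      rw [← e, h]
      ring

variable {p : ℕ} [Fact p.Prime] [CharP R p]

instance : CharP (AddMonoidAlgebra R G) p := by
  refine charP_of_injective_algebraMap (R := R) ?_ p
  intro r s h
  have := congrArg (pair fun _ => (1 : R)) h
  simpa [AddMonoidAlgebra.coe_algebraMap] using this

end GroupAlgebra

section CyclicGroupAlgebra

lemma sum_range_natCast {p : ℕ} [Fact p.Prime] {M : Type*} [AddCommMonoid M] (f : ZMod p → M) :
    ∑ k ∈ Finset.range p, f (k : ZMod p) = ∑ k, f k := by
  refine Finset.sum_bij (fun k _ => (k : ZMod p)) (by simp) ?_ ?_ (by simp)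
  · intro a ha b hb hab
    rw [Finset.mem_range] at ha hb
    simpa [ZMod.val_natCast, Nat.mod_eq_of_lt ha, Nat.mod_eq_of_lt hb] using congrArg ZMod.val hab
  · intro b _
    exact ⟨b.val, Finset.mem_range.mpr (ZMod.val_lt b), by simp⟩

variable {R : Type*} [CommRing R] {p : ℕ} [Fact p.Prime]

/-- The canonical generator of the group algebra of `ZMod p`. -/
noncomputable def gen (R : Type*) [CommRing R] (p : ℕ) : AddMonoidAlgebra R (ZMod p) :=
  AddMonoidAlgebra.single 1 1

lemma gen_pow (k : ℕ) : gen R p ^ k = AddMonoidAlgebra.single (k : ZMod p) 1 := by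
  simp [gen, AddMonoidAlgebra.single_pow]

lemma gen_sub_one_pow [CharP R p] : (gen R p - 1) ^ p = 0 := by
  rw [sub_pow_char, gen_pow, one_pow, CharP.cast_eq_zero, AddMonoidAlgebra.one_def, sub_self]

lemma gen_sub_one_pow_pred [CharP R p] :
    (gen R p - 1) ^ (p - 1) = ∑ k ∈ Finset.range p, gen R p ^ k := by
  have hp : p.Prime := Fact.out
  have h := Polynomial.cyclotomic_mul_prime_eq_pow_of_not_dvd R (p := p) (n := 1)
    (fun h => hp.one_lt.ne' (Nat.dvd_one.mp h))
  rw [one_mul, Polynomial.cyclotomic_prime, Polynomial.cyclotomic_one] at h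
  simpa using (congrArg (Polynomial.aeval (gen R p)) h).symm

lemma exists_gen_pow_sub_one (k : ℕ) :
    ∃ w, gen R p ^ k - 1 = k • (gen R p - 1) + (gen R p - 1) ^ 2 * w := by
  induction k with
  | zero => exact ⟨0, by simp⟩
  | succ k ih =>
    obtain ⟨w, hw⟩ := ih
    refine ⟨k + gen R p * w, ?_⟩
    have : gen R p ^ (k + 1) - 1 = gen R p * (gen R p ^ k - 1) + (gen R p - 1) := by ring
    rw [this, hw]
    simp only [nsmul_eq_mul]
    push_cast
    ring

lemma sum_smul_sub_one_pow_pred [CharP R p] {ι : Type*} [Fintype ι] (θ : ι → R) (a : ι → ZMod p) :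
    (∑ i, θ i • ((AddMonoidAlgebra.single (a i) 1 : AddMonoidAlgebra R (ZMod p)) - 1)) ^ (p - 1) =
      (∑ i, θ i * ((a i).val : R)) ^ (p - 1) • ∑ k ∈ Finset.range p, gen R p ^ k := by
  have key (i : ι) : ∃ w, (AddMonoidAlgebra.single (a i) 1 : AddMonoidAlgebra R (ZMod p)) - 1 =
      (a i).val • (gen R p - 1) + (gen R p - 1) ^ 2 * w := by
    obtain ⟨w, hw⟩ := exists_gen_pow_sub_one (R := R) (p := p) (a i).val
    refine ⟨w, ?_⟩
    rw [← hw, gen_pow, ZMod.natCast_val, ZMod.cast_id]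
  choose w hw using key
  set s := gen R p with hs
  set l := ∑ i, θ i * ((a i).val : R)
  have e : ∑ i, θ i • ((AddMonoidAlgebra.single (a i) 1 : AddMonoidAlgebra R (ZMod p)) - 1) =
      (s - 1) * (algebraMap R _ l + (s - 1) * ∑ i, θ i • w i) := by
    simp only [hw, l, map_sum, map_mul, map_natCast, mul_add, Finset.mul_sum,
      ← Finset.sum_add_distrib]
    refine Finset.sum_congr rfl fun i _ => ?_
    simp only [nsmul_eq_mul]
    simp only [Algebra.smul_def]
    ring
  obtain ⟨d, hd⟩ := sub_dvd_pow_sub_pow (algebraMap R _ l + (s - 1) * ∑ i, θ i • w i)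
    (algebraMap R _ l) (p - 1)
  have hp : p - 1 + 1 = p := Nat.sub_add_cancel (Fact.out : p.Prime).pos
  have h0 : (s - 1) ^ (p - 1) * (s - 1) = 0 := by rw [← pow_succ, hp, gen_sub_one_pow]
  rw [e, mul_pow, eq_add_of_sub_eq hd, ← gen_sub_one_pow_pred, ← hs, Algebra.smul_def, map_pow]
  linear_combination (∑ i, θ i • w i) * d * h0

lemma pair_sum_gen_pow (f : ZMod p → R) :
    pair f (∑ k ∈ Finset.range p, gen R p ^ k) = ∑ k, f k := by
  simp only [gen_pow, map_sum, pair_single, one_mul, sum_range_natCast]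

end CyclicGroupAlgebra

section Cycle

variable (p ν : ℕ)

/-- The coefficient ring. -/
abbrev Coeff := MvPolynomial (Fin ν) (ZMod p)

/-- A generic combination of augmented generators of the group algebra of `(ℤ/p)^ν`. -/
noncomputable def generic : AddMonoidAlgebra (Coeff p ν) (Fin ν → ZMod p) :=
  ∑ i, (MvPolynomial.X i : Coeff p ν) • (AddMonoidAlgebra.single (Pi.single i 1) 1 - 1)

/-- A chain of dimension `2 k` that is a cycle modulo the action of `(ℤ/p)^ν`. -/
noncomputable def fundamental : ℕ → Chain (Coeff p ν) (Fin ν → ZMod p)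
  | 0 => Finsupp.single [0] 1
  | k + 1 => cons _ 0 (act (generic p ν) (cons _ 0 (act (generic p ν ^ (p - 1)) (fundamental k))))

variable {p ν} [Fact p.Prime]

lemma generic_pow : generic p ν ^ p = 0 := by
  rw [generic, sum_pow_char]
  refine Finset.sum_eq_zero fun i _ => ?_
  rw [smul_pow, sub_pow_char, AddMonoidAlgebra.single_pow, one_pow, one_pow]
  have : p • (Pi.single i 1 : Fin ν → ZMod p) = 0 := by
    rw [← Pi.single_smul]
    simp
  rw [this, ← AddMonoidAlgebra.one_def, sub_self, smul_zero]

lemma fundamental_eq_cons (k : ℕ) : ∃ x, fundamental p ν k = cons _ 0 x := by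
  cases k with
  | zero => exact ⟨Finsupp.single [] 1, by simp [fundamental]⟩
  | succ k => exact ⟨_, rfl⟩

lemma act_generic_apply (x : Chain (Coeff p ν) (Fin ν → ZMod p)) :
    act (generic p ν) x = ∑ i, (MvPolynomial.X i : Coeff p ν) •
      (push _ (Pi.single i 1 + ·) x - x) := by
  simp [generic, LinearMap.sum_apply]

lemma bd_fundamental_succ {k : ℕ}
    (h : act (generic p ν ^ (p - 1)) (bd _ (fundamental p ν k)) = 0) :
    bd _ (fundamental p ν (k + 1)) =
      act (generic p ν) (cons _ 0 (act (generic p ν ^ (p - 1)) (fundamental p ν k))) := by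
  have hp : 1 + (p - 1) = p := Nat.add_sub_cancel' (Fact.out : p.Prime).pos
  have h1 : bd _ (cons _ 0 (act (generic p ν ^ (p - 1)) (fundamental p ν k))) =
      act (generic p ν ^ (p - 1)) (fundamental p ν k) := by
    rw [bd_cons, bd_act, h, map_zero, sub_zero]
  rw [fundamental, bd_cons, bd_act, h1, ← act_mul, ← pow_succ', Nat.add_comm, hp, generic_pow]
  simp

lemma act_bd_fundamental (k : ℕ) :
    act (generic p ν ^ (p - 1)) (bd _ (fundamental p ν k)) = 0 := by
  have hp := (Fact.out : p.Prime).two_le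
  induction k with
  | zero =>
    have : p - 1 = (p - 2) + 1 := by omega
    rw [this, pow_succ, act_mul]
    have : act (generic p ν) (bd _ (fundamental p ν 0)) = 0 := by
      simp [act_generic_apply, fundamental, bdList]
    rw [this, map_zero]
  | succ k ih =>
    rw [bd_fundamental_succ ih, ← act_mul, ← pow_succ, Nat.sub_add_cancel (by omega), generic_pow]
    simp

lemma apply_bd_fundamental (k : ℕ) {h : Chain (Coeff p ν) (Fin ν → ZMod p) →ₗ[Coeff p ν] Coeff p ν}
    (hinv : ∀ u x, h (push _ (u + ·) x) = h x) (h0 : h (Finsupp.single [] 1) = 0) :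
    h (bd _ (fundamental p ν k)) = 0 := by
  cases k with
  | zero => simpa [fundamental, bdList] using h0
  | succ k =>
    rw [bd_fundamental_succ (act_bd_fundamental k), act_generic_apply]
    simp [hinv]

/-- The generic linear form evaluated at a character. -/
noncomputable def weight (χ : (Fin ν → ZMod p) →+ ZMod p) : Coeff p ν :=
  ∑ i, (MvPolynomial.X i : Coeff p ν) * ((χ (Pi.single i 1)).val : Coeff p ν)

lemma weight_ne_zero {χ : (Fin ν → ZMod p) →+ ZMod p} (hχ : χ ≠ 0) : weight χ ≠ 0 := by
  contrapose! hχ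
  refine AddMonoidHom.functions_ext _ _ _ fun i a => ?_
  have h1 : χ (Pi.single i 1) = 0 := by
    have := congrArg (MvPolynomial.coeff (Finsupp.single i 1)) hχ
    have e (j : Fin ν) : MvPolynomial.X j * ((χ (Pi.single j 1)).val : Coeff p ν) =
        MvPolynomial.C (χ (Pi.single j 1)) * MvPolynomial.X j := by
      rw [mul_comm, ← map_natCast MvPolynomial.C, ZMod.natCast_val, ZMod.cast_id]
    simp only [weight, MvPolynomial.coeff_sum, e, MvPolynomial.coeff_C_mul,
      MvPolynomial.coeff_X] at this
    simpa [Finsupp.single_left_inj] using this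
  have : (Pi.single i a : Fin ν → ZMod p) = a.val • Pi.single i 1 := by
    rw [← Pi.single_smul, nsmul_one, ZMod.natCast_val, ZMod.cast_id]
  rw [this, map_nsmul, h1, smul_zero, AddMonoidHom.zero_apply]

lemma pair_generic {χ : (Fin ν → ZMod p) →+ ZMod p} {f : ZMod p → ZMod p → Coeff p ν}
    (hf : ∀ k, ∑ l, f k l = (k.val : Coeff p ν)) :
    pair (fun u => pair (fun v => f (χ u) (χ v)) (generic p ν ^ (p - 1))) (generic p ν) =
      weight χ ^ p := by
  have h1 (k : ZMod p) : pair (fun v => f k (χ v)) (generic p ν ^ (p - 1)) =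
      weight χ ^ (p - 1) * (k.val : Coeff p ν) := by
    rw [← pair_mapDomain χ (f k), map_pow, generic]
    simp only [map_sum, map_smul, map_sub, map_one]
    simp only [AddMonoidAlgebra.mapDomainAlgHom_apply, AddMonoidAlgebra.mapDomain_single]
    rw [sum_smul_sub_one_pow_pred, map_smul, pair_sum_gen_pow, hf, smul_eq_mul, weight]
  simp only [h1]
  rw [← pow_sub_one_mul (Fact.out : p.Prime).ne_zero (weight χ)]
  conv_lhs => rw [generic]
  simp only [map_sum, map_smul, map_sub, pair_one, pair_single, map_zero,
    ZMod.val_zero, Nat.cast_zero, mul_zero, sub_zero, one_mul, smul_eq_mul]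
  exact (Finset.sum_congr rfl fun i _ => by ring).trans (Finset.mul_sum _ _ _).symm

/-- A 2-cochain on `(ℤ/p)^ν` is of Bockstein type for a character `χ` if it is an invariant
cochain representing the Bockstein of `χ`. -/
def IsBockstein (y : (Fin ν → ZMod p) → (Fin ν → ZMod p) → (Fin ν → ZMod p) → Coeff p ν) : Prop :=
  (∀ h a b c, y (h + a) (h + b) (h + c) = y a b c) ∧
  ∃ χ : (Fin ν → ZMod p) →+ ZMod p, χ ≠ 0 ∧ ∃ f : ZMod p → ZMod p → Coeff p ν,
    (∀ k, ∑ l, f k l = (k.val : Coeff p ν)) ∧ ∀ u v, y 0 u (u + v) = f (χ u) (χ v)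

lemma cup_fundamental_ne_zero
    {ys : List ((Fin ν → ZMod p) → (Fin ν → ZMod p) → (Fin ν → ZMod p) → Coeff p ν)}
    (hys : ∀ y ∈ ys, IsBockstein y) : cup ys (fundamental p ν ys.length) ≠ 0 := by
  induction ys with
  | nil => simp [fundamental, cupList]
  | cons y ys ih =>
    have ih := ih fun z hz => hys z (List.mem_cons_of_mem _ hz)
    obtain ⟨-, χ, hχ, f, hf, hy⟩ := hys y List.mem_cons_self
    obtain ⟨x, hx⟩ := fundamental_eq_cons (p := p) (ν := ν) ys.length
    rw [List.length_cons, fundamental, hx,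
      cup_act (fun z hz => (hys z (List.mem_cons_of_mem _ hz)).1), ← hx]
    simp only [hy]
    rw [pair_generic hf]
    exact mul_ne_zero (pow_ne_zero _ (weight_ne_zero hχ)) ih

theorem exists_isFine_cupList_ne_zero (m L : ℕ)
    {ys : List ((ℕ → Fin ν → ZMod p) → (ℕ → Fin ν → ZMod p) → (ℕ → Fin ν → ZMod p) → Coeff p ν)}
    (hcoc : ∀ y ∈ ys, ∀ a b c d, y b c d - y a c d + y a b d - y a b c = 0)
    (hinv : ∀ y ∈ ys, ∀ (h : Fin ν → ZMod p) (a b c : ℕ → Fin ν → ZMod p),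
      y (fun s => h + a s) (fun s => h + b s) (fun s => h + c s) = y a b c)
    (hbock : ∀ y ∈ ys, ∃ χ : (Fin ν → ZMod p) →+ ZMod p, χ ≠ 0 ∧
      ∃ f : ZMod p → ZMod p → Coeff p ν, (∀ k, ∑ l, f k l = (k.val : Coeff p ν)) ∧
        ∀ u v, y (fun _ => 0) (fun _ => u) (fun _ => u + v) = f (χ u) (χ v)) :
    ∃ l, IsFine m L l ∧ cupList ys l ≠ 0 := by
  by_contra! hcon
  set N := m * L
  set Q := fundamental p ν ys.length
  let J : (Fin ν → ZMod p) → Chain (Coeff p ν) (ℕ → Fin ν → ZMod p) →ₗ[Coeff p ν] _ :=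
    fun g => cons (Coeff p ν) (fun _ => g)
  have hJ (g : Fin ν → ZMod p) (x) : bd (Coeff p ν) (J g x) = x - J g (bd _ x) := bd_cons _ _
  have hzero : cup ys (coneMap (contraction (Coeff p ν) N) Q) = 0 := by
    have hmem := coneMap_contraction_mem_supported m L Q
    rw [cup, Finsupp.linearCombination_apply]
    refine Finset.sum_eq_zero fun l hl => ?_
    simp only [hcon l (hmem hl), smul_zero]
  have hpush : cup ys (push _ (fun g _ => g) Q) ≠ 0 := by
    rw [cup_push]
    have hlen : ys.length = (ys.map fun (y : (ℕ → Fin ν → ZMod p) → (ℕ → Fin ν → ZMod p) →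
        (ℕ → Fin ν → ZMod p) → Coeff p ν) (a b c : Fin ν → ZMod p) =>
          y (fun _ => a) (fun _ => b) (fun _ => c)).length := by simp
    simp only [Q]
    rw [hlen]
    refine cup_fundamental_ne_zero ?_
    simp only [List.mem_map]
    rintro _ ⟨y, hy, rfl⟩
    exact ⟨fun h a b c => hinv y hy h (fun _ => a) (fun _ => b) (fun _ => c), hbock y hy⟩
  have hcupinv (h : Fin ν → ZMod p) (x) :
      cup ys (push _ (fun w s => h + w s) x) = cup ys x := by
    rw [cup_push]
    conv_rhs => rw [← List.map_id ys]
    congr 2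
    refine List.map_congr_left fun y hy => ?_
    ext a b c
    simp [hinv y hy]
  have hD := bd_homotopyMap (fun g => bd_contraction (R := Coeff p ν) N g) hJ Q
  have hbdD := apply_bd_fundamental (p := p) (ν := ν) ys.length
    (h := cup ys ∘ₗ homotopyMap (contraction (Coeff p ν) N) J)
    (fun u x => by
      rw [LinearMap.comp_apply, ← push_homotopyMap (τ := fun w s => u + w s), hcupinv]
      · rfl
      · exact fun g x => push_contraction N g u x
      · exact fun g x => push_cons _ _ _)
    (by simp [homotopyList])
  have := congrArg (cup ys) hD
  rw [cup_bd ys hcoc, map_sub, map_sub, hzero, coneMap_cons_eq_push] at this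
  rw [LinearMap.comp_apply] at hbdD
  rw [hbdD] at this
  apply hpush
  linear_combination this

end Cycle

section Winding

variable {W : Type*}

/-- The winding number of the phase `Θ` around the triangle `a b c`. -/
noncomputable def winding (Θ : W → ℝ) (a b c : W) : ℤ :=
  round (Θ c - Θ a) - round (Θ b - Θ a) - round (Θ c - Θ b)

lemma winding_cocycle (Θ : W → ℝ) (a b c d : W) :
    winding Θ b c d - winding Θ a c d + winding Θ a b d - winding Θ a b c = 0 := by
  simp only [winding]
  ring

lemma sum_round_sub_div {p : ℕ} (hp : 0 < p) (k : ℕ) :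
    ∑ s ∈ Finset.range p, round (((s : ℝ) - k) / p) =
      ∑ s ∈ Finset.range p, round ((s : ℝ) / p) - k := by
  induction k with
  | zero => simp
  | succ k ih =>
    have hp' : (p : ℝ) ≠ 0 := by positivity
    have h1 := Finset.sum_range_succ (fun s : ℕ => round (((s : ℝ) - (k + 1 : ℕ)) / p)) p
    have h2 := Finset.sum_range_succ' (fun s : ℕ => round (((s : ℝ) - (k + 1 : ℕ)) / p)) p
    have h3 : round (((p : ℝ) - (k + 1 : ℕ)) / p) = round ((((0 : ℕ) : ℝ) - (k + 1 : ℕ)) / p) + 1 := by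
      rw [← round_add_one]
      congr 1
      field_simp
      push_cast
      ring
    have h4 : ∀ s : ℕ, (((s + 1 : ℕ) : ℝ) - (k + 1 : ℕ)) / p = ((s : ℝ) - k) / p := by
      intro s
      push_cast
      ring
    simp only [h4, ih] at h2
    rw [h3] at h1
    push_cast at h1 h2 ⊢
    linarith

/-- The winding cocycle of the standard phase on `ℤ/p`. -/
noncomputable def bockstein {p : ℕ} (x y : ZMod p) : ℤ :=
  round (((x + y).val : ℝ) / p) - round ((x.val : ℝ) / p) -
    round ((((x + y).val : ℝ) - x.val) / p)

lemma sum_bockstein {p : ℕ} [Fact p.Prime] (x : ZMod p) :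
    ∑ y, bockstein x y = x.val - p * round ((x.val : ℝ) / p) := by
  have hp : p.Prime := Fact.out
  have h1 : ∑ y, bockstein x y = ∑ y : ZMod p, (round ((y.val : ℝ) / p) - round ((x.val : ℝ) / p) -
      round (((y.val : ℝ) - x.val) / p)) :=
    (Equiv.sum_comp (Equiv.addLeft x) fun y : ZMod p => (round ((y.val : ℝ) / p) -
      round ((x.val : ℝ) / p) - round (((y.val : ℝ) - x.val) / p)))
  rw [h1, ← sum_range_natCast]
  have h2 : ∀ s ∈ Finset.range p, round (((s : ZMod p).val : ℝ) / p) - round ((x.val : ℝ) / p) -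
      round ((((s : ZMod p).val : ℝ) - x.val) / p) =
      round ((s : ℝ) / p) - round ((x.val : ℝ) / p) - round (((s : ℝ) - x.val) / p) := by
    intro s hs
    rw [ZMod.val_natCast_of_lt (Finset.mem_range.mp hs)]
  rw [Finset.sum_congr rfl h2]
  simp only [Finset.sum_sub_distrib, sum_round_sub_div hp.pos, Finset.sum_const,
    Finset.card_range, nsmul_eq_mul]
  ring

variable {p ν : ℕ} [Fact p.Prime]

theorem exists_isFine_winding_ne_zero (m L : ℕ) {ι : Type*} [Fintype ι]
    (χ : ι → (Fin ν → ZMod p) →+ ZMod p) (hχ : ∀ q, χ q ≠ 0)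
    (Θ : ι → (ℕ → Fin ν → ZMod p) → ℝ)
    (hΘ : ∀ q (h : Fin ν → ZMod p) (w : ℕ → Fin ν → ZMod p),
      ∃ k : ℤ, Θ q (fun s => h + w s) = Θ q w + ((χ q h).val : ℝ) / p + k) :
    ∃ l : List (ℕ → Fin ν → ZMod p), IsFine m L l ∧ l.length = 2 * Fintype.card ι + 1 ∧
      ∀ q, ∃ a ∈ l, ∃ b ∈ l, ∃ c ∈ l, winding (Θ q) a b c ≠ 0 := by
  let y (q : ι) (a b c : ℕ → Fin ν → ZMod p) : Coeff p ν := (winding (Θ q) a b c : ℤ)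
  have hex : ∃ l, IsFine m L l ∧ cupList (Finset.univ.toList.map y) l ≠ 0 := by
    apply exists_isFine_cupList_ne_zero
    all_goals simp only [List.mem_map, Finset.mem_toList, Finset.mem_univ, true_and,
      forall_exists_index, forall_apply_eq_imp_iff]
    · intro q a b c d
      have := congrArg (Int.cast (R := Coeff p ν)) (winding_cocycle (Θ q) a b c d)
      simpa [y] using this
    · intro q h a b c
      simp only [y]
      congr 1
      obtain ⟨ka, ha⟩ := hΘ q h a
      obtain ⟨kb, hb⟩ := hΘ q h b
      obtain ⟨kc, hc⟩ := hΘ q h c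
      have key (u v : ℝ) (k l : ℤ) (t : ℝ) : round (v + t + l - (u + t + k)) =
          round (v - u) + (l - k) := by
        rw [← round_add_intCast]
        congr 1
        push_cast
        ring
      simp only [winding, ha, hb, hc, key]
      ring
    · intro q
      refine ⟨χ q, hχ q, fun x y => (bockstein x y : ℤ), fun k => ?_, fun u v => ?_⟩
      · rw [← Int.cast_sum, sum_bockstein]
        push_cast
        simp
      · simp only [y]
        congr 1
        have key (u : Fin ν → ZMod p) : ∃ k : ℤ, Θ q (fun _ => u) =
            Θ q (fun _ => 0) + ((χ q u).val : ℝ) / p + k := by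
          obtain ⟨k, hk⟩ := hΘ q u (fun _ => 0)
          refine ⟨k, ?_⟩
          rw [← hk]
          simp
        obtain ⟨ku, hu⟩ := key u
        obtain ⟨kv, hv⟩ := key (u + v)
        have e1 : Θ q (fun _ => u + v) - Θ q (fun _ => 0) =
          ((χ q (u + v)).val : ℝ) / p + (kv : ℤ) := by rw [hv]; ring
        have e2 : Θ q (fun _ => u) - Θ q (fun _ => 0) =
          ((χ q u).val : ℝ) / p + (ku : ℤ) := by rw [hu]; ring
        have e3 : Θ q (fun _ => u + v) - Θ q (fun _ => u) =
            (((χ q (u + v)).val : ℝ) - (χ q u).val) / p + (kv - ku : ℤ) := by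
          rw [hv, hu]; push_cast; ring
        simp only [winding, e1, e2, e3, round_add_intCast, bockstein, map_add]
        ring
  obtain ⟨l, hl, hne⟩ := hex
  obtain ⟨h1, h2⟩ := cupList_ne_zero hne
  refine ⟨l, hl, by simpa using h1, fun q => ?_⟩
  obtain ⟨a, ha, b, hb, c, hc, h⟩ := h2 (y q) (List.mem_map_of_mem (by simp))
  exact ⟨a, ha, b, hb, c, hc, fun h0 => h (by simp [y, h0])⟩

end Winding

section Phase

open Complex

/-- If no vertex of a triangle is close to the origin, then the winding number around it is zero. -/
lemma abs_sub_round_lt {z w : ℂ} (hz : z ≠ 0) (hw : w ≠ 0) (h : ‖z - w‖ < ‖z‖) :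
    |w.arg / (2 * Real.pi) - z.arg / (2 * Real.pi) -
      round (w.arg / (2 * Real.pi) - z.arg / (2 * Real.pi))| < 1 / 4 := by
  have hpi := Real.pi_pos
  set d := w.arg / (2 * Real.pi) - z.arg / (2 * Real.pi) with hd
  have hre : 0 < w.re * z.re + w.im * z.im := by
    have h2 : ‖z - w‖ ^ 2 < ‖z‖ ^ 2 := by gcongr
    rw [Complex.sq_norm, Complex.sq_norm, Complex.normSq_apply, Complex.normSq_apply] at h2
    simp only [sub_re, sub_im] at h2
    nlinarith [mul_self_nonneg w.re, mul_self_nonneg w.im]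
  have hcos : 0 < Real.cos (2 * Real.pi * (d - round d)) := by
    have e : 2 * Real.pi * (d - round d) = (w.arg - z.arg) - round d * (2 * Real.pi) := by
      rw [hd]
      field_simp
    rw [e, Real.cos_sub_int_mul_two_pi, Real.cos_sub, cos_arg hw, cos_arg hz, sin_arg, sin_arg]
    have hz' := norm_pos_iff.mpr hz
    have hw' := norm_pos_iff.mpr hw
    have : w.re / ‖w‖ * (z.re / ‖z‖) + w.im / ‖w‖ * (z.im / ‖z‖) =
      (w.re * z.re + w.im * z.im) / (‖w‖ * ‖z‖) := by field_simp
    rw [this]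
    positivity
  by_contra! hcon
  have h1 := abs_sub_round d
  rw [← Real.cos_abs, abs_mul, abs_of_pos (by positivity : 0 < 2 * Real.pi)] at hcos
  refine absurd hcos (not_lt.mpr (Real.cos_nonpos_of_pi_div_two_le_of_le ?_ ?_)) <;> nlinarith

variable {p ν : ℕ} [Fact p.Prime]

/-- The phase of an equivariant complex function, completed by the phase of the first letter
where the function vanishes. -/
noncomputable def phase (χ : (Fin ν → ZMod p) →+ ZMod p) (F : (ℕ → Fin ν → ZMod p) → ℂ)
    (w : ℕ → Fin ν → ZMod p) : ℝ :=
  open Classical in if F w = 0 then ((χ (w 0)).val : ℝ) / p else (F w).arg / (2 * Real.pi)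

lemma exists_phase_add {χ : (Fin ν → ZMod p) →+ ZMod p} {F : (ℕ → Fin ν → ZMod p) → ℂ}
    (hF : ∀ (h : Fin ν → ZMod p) w, F (fun s => h + w s) = ZMod.stdAddChar (χ h) * F w)
    (h : Fin ν → ZMod p) (w : ℕ → Fin ν → ZMod p) :
    ∃ k : ℤ, phase χ F (fun s => h + w s) = phase χ F w + ((χ h).val : ℝ) / p + k := by
  have hp : (p : ℝ) ≠ 0 := by
    have := (Fact.out : p.Prime).pos
    positivity
  by_cases h0 : F w = 0
  · have h1 : F (fun s => h + w s) = 0 := by rw [hF, h0, mul_zero]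
    refine ⟨-(((χ h).val + (χ (w 0)).val) / p : ℕ), ?_⟩
    have := Nat.div_add_mod ((χ h).val + (χ (w 0)).val) p
    have : (p : ℝ) * (((χ h).val + (χ (w 0)).val) / p : ℕ) +
      (((χ h).val + (χ (w 0)).val) % p : ℕ) = (χ h).val + (χ (w 0)).val := by exact_mod_cast this
    simp only [phase, h0, h1, if_true, map_add, ZMod.val_add]
    generalize ((χ h).val + (χ (w 0)).val) / p = k at this ⊢
    push_cast
    field_simp
    linarith
  · have hexp : (ZMod.stdAddChar (χ h) : ℂ) =
        Complex.exp ((2 * Real.pi * ((χ h).val / p : ℝ) : ℝ) * I) := by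
      rw [ZMod.stdAddChar_apply, ZMod.toCircle_apply]
      congr 1
      push_cast
      ring
    have hne : (ZMod.stdAddChar (χ h) : ℂ) ≠ 0 := by rw [hexp]; exact Complex.exp_ne_zero _
    have h1 : F (fun s => h + w s) ≠ 0 := by rw [hF]; exact mul_ne_zero hne h0
    have harg : (((ZMod.stdAddChar (χ h) : ℂ).arg : ℝ) : Real.Angle) =
        ((2 * Real.pi * ((χ h).val / p : ℝ) : ℝ) : Real.Angle) := by
      rw [hexp, Complex.exp_mul_I, ← Complex.ofReal_cos, ← Complex.ofReal_sin]
      simpa only [Real.Angle.cos_coe, Real.Angle.sin_coe] using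
        Complex.arg_cos_add_sin_mul_I_coe_angle ((2 * Real.pi * ((χ h).val / p : ℝ) : ℝ) : Real.Angle)
    have h2 := Complex.arg_mul_coe_angle hne h0
    rw [← hF, harg, ← Real.Angle.coe_add, Real.Angle.angle_eq_iff_two_pi_dvd_sub] at h2
    obtain ⟨k, hk⟩ := h2
    refine ⟨k, ?_⟩
    have hpi := Real.pi_pos
    simp only [phase, h0, h1, if_false]
    rw [eq_add_of_sub_eq hk]
    field_simp
    ring

/-- A Borsuk–Ulam type theorem: equivariant complex functions are simultaneously small, in terms
of their variation, on a fine sequence of words. -/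
theorem exists_isFine_norm_le (m L : ℕ) {ι : Type*} [Fintype ι]
    (χ : ι → (Fin ν → ZMod p) →+ ZMod p) (hχ : ∀ q, χ q ≠ 0)
    (F : ι → (ℕ → Fin ν → ZMod p) → ℂ)
    (hF : ∀ q (h : Fin ν → ZMod p) w, F q (fun s => h + w s) = ZMod.stdAddChar (χ q h) * F q w) :
    ∃ l : List (ℕ → Fin ν → ZMod p), IsFine m L l ∧ l.length = 2 * Fintype.card ι + 1 ∧
      ∀ q, ∃ a ∈ l, ∃ b ∈ l, ‖F q a‖ ≤ ‖F q a - F q b‖ := by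
  obtain ⟨l, hl, hlen, hw⟩ := exists_isFine_winding_ne_zero m L χ hχ
    (fun q => phase (χ q) (F q)) (fun q => exists_phase_add (hF q))
  refine ⟨l, hl, hlen, fun q => ?_⟩
  obtain ⟨a, ha, b, hb, c, hc, hne⟩ := hw q
  by_contra! hcon
  have h0 : ∀ a ∈ l, F q a ≠ 0 := fun a ha h => by
    simpa [h] using hcon a ha a ha
  have key : ∀ a ∈ l, ∀ b ∈ l, |phase (χ q) (F q) b - phase (χ q) (F q) a -
      round (phase (χ q) (F q) b - phase (χ q) (F q) a)| < 1 / 4 := by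
    intro a ha b hb
    simp only [phase, h0 a ha, h0 b hb, if_false]
    exact abs_sub_round_lt (h0 a ha) (h0 b hb) (hcon a ha b hb)
  have h1 := abs_lt.mp (key a ha c hc)
  have h2 := abs_lt.mp (key a ha b hb)
  have h3 := abs_lt.mp (key b hb c hc)
  apply hne
  have h4 : |((winding (phase (χ q) (F q)) a b c : ℤ) : ℝ)| < 1 := by
    simp only [winding]
    push_cast
    rw [abs_lt]
    constructor <;> linarith [h1.1, h1.2, h2.1, h2.2, h3.1, h3.2]
  exact Int.abs_lt_one_iff.mp (by exact_mod_cast h4)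

end Phase

section Fourier

variable {p ν : ℕ} [Fact p.Prime]

/-- The homomorphism to `ℤ/p` given by the dot product with a vector. -/
def dot (y : Fin ν → ZMod p) : (Fin ν → ZMod p) →+ ZMod p where
  toFun g := dotProduct y g
  map_zero' := dotProduct_zero y
  map_add' := dotProduct_add y

lemma dot_apply (y g : Fin ν → ZMod p) : dot y g = dotProduct y g := rfl

lemma exists_dot_ne_zero {y : Fin ν → ZMod p} (hy : y ≠ 0) : ∃ g, dot y g ≠ 0 := by
  obtain ⟨i, hi⟩ := Function.ne_iff.mp hy
  exact ⟨Pi.single i 1, by simpa [dot_apply] using hi⟩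

lemma sum_stdAddChar_dot {k : Fin ν → ZMod p} (hk : k ≠ 0) :
    ∑ y, (ZMod.stdAddChar (dot k y) : ℂ) = 0 := by
  obtain ⟨g, hg⟩ := exists_dot_ne_zero hk
  have h : (ZMod.stdAddChar (N := p)).compAddMonoidHom (dot k) ≠ 1 := by
    rw [AddChar.ne_one_iff]
    refine ⟨g, fun h => hg (ZMod.injective_stdAddChar ?_)⟩
    simpa using h
  simpa using AddChar.sum_eq_zero_of_ne_one h

/-- The Fourier transform of a function on `(ℤ/p)^ν`. -/
noncomputable def fourier (f : (Fin ν → ZMod p) → ℂ) (y : Fin ν → ZMod p) : ℂ :=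
  ∑ g, ZMod.stdAddChar (dot y g) * f g

lemma sum_fourier (f : (Fin ν → ZMod p) → ℂ) (g : Fin ν → ZMod p) :
    ∑ y, ZMod.stdAddChar (-dot y g) * fourier f y =
      Fintype.card (Fin ν → ZMod p) * f g := by
  simp only [fourier, Finset.mul_sum]
  rw [Finset.sum_comm]
  have key (h : Fin ν → ZMod p) : ∑ y, (ZMod.stdAddChar (-dot y g) : ℂ) *
      (ZMod.stdAddChar (dot y h) * f h) =
      if h = g then Fintype.card (Fin ν → ZMod p) * f g else 0 := by
    have e (y : Fin ν → ZMod p) : (ZMod.stdAddChar (-dot y g) : ℂ) *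
        (ZMod.stdAddChar (dot y h) * f h) = ZMod.stdAddChar (dot (h - g) y) * f h := by
      rw [← mul_assoc, ← AddChar.map_add_eq_mul]
      congr 2
      rw [dot_apply, dot_apply, dot_apply, sub_dotProduct, dotProduct_comm h, dotProduct_comm g]
      ring
    simp only [e, ← Finset.sum_mul]
    split_ifs with hgh
    · subst hgh
      have : dot (0 : Fin ν → ZMod p) = 0 := by ext; simp [dot_apply]
      simp [this]
    · rw [sum_stdAddChar_dot (sub_ne_zero.mpr hgh), zero_mul]
  simp only [key, Finset.sum_ite_eq', Finset.mem_univ, if_true]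

lemma norm_sub_le_of_fourier_le {f : (Fin ν → ZMod p) → ℂ} {ε : ℝ} (hε : 0 ≤ ε)
    (h : ∀ y, y ≠ 0 → ‖fourier f y‖ ≤ ε) (g g' : Fin ν → ZMod p) : ‖f g - f g'‖ ≤ 2 * ε := by
  have h1 : (Fintype.card (Fin ν → ZMod p) : ℂ) * (f g - f g') =
      ∑ y, (ZMod.stdAddChar (-dot y g) - ZMod.stdAddChar (-dot y g')) * fourier f y := by
    simp only [sub_mul, Finset.sum_sub_distrib, sum_fourier, mul_sub]
  have h2 : ‖(Fintype.card (Fin ν → ZMod p) : ℂ) * (f g - f g')‖ ≤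
      Fintype.card (Fin ν → ZMod p) * (2 * ε) := by
    rw [h1, ← nsmul_eq_mul, ← Finset.card_univ]
    refine (norm_sum_le _ _).trans (Finset.sum_le_card_nsmul _ _ _ fun y _ => ?_)
    by_cases hy : y = 0
    · have : dot (0 : Fin ν → ZMod p) = 0 := by ext; simp [dot_apply]
      simp [hy, this, hε]
    · rw [norm_mul]
      refine mul_le_mul ((norm_sub_le _ _).trans ?_) (h y hy) (norm_nonneg _) (by norm_num)
      rw [AddChar.norm_apply, AddChar.norm_apply]
      norm_num
  rw [norm_mul, Complex.norm_natCast] at h2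
  exact le_of_mul_le_mul_left h2 (by exact_mod_cast Fintype.card_pos)

end Fourier

section Frequency

variable {G : Type*} [DecidableEq G]

/-- The frequency of the letter `g` in the `a`-th block of length `L` of a word. -/
noncomputable def freq (L : ℕ) (w : ℕ → G) (g : G) (a : ℕ) : ℝ :=
  ((Finset.range L).filter fun r => w (a * L + r) = g).card / L

lemma freq_nonneg (L : ℕ) (w : ℕ → G) (g : G) (a : ℕ) : 0 ≤ freq L w g a := by
  unfold freq
  positivity

lemma sum_freq [Fintype G] {L : ℕ} (hL : 0 < L) (w : ℕ → G) (a : ℕ) : ∑ g, freq L w g a = 1 := by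
  have h := Finset.card_eq_sum_card_fiberwise (s := Finset.range L) (t := Finset.univ)
    (f := fun r => w (a * L + r)) (fun _ _ => Finset.mem_coe.mpr (Finset.mem_univ _))
  rw [Finset.card_range] at h
  have hL' : (L : ℝ) ≠ 0 := by positivity
  simp only [freq]
  rw [← Finset.sum_div, div_eq_one_iff_eq hL']
  exact_mod_cast h.symm

lemma freq_add [AddCommGroup G] (L : ℕ) (w : ℕ → G) (g h : G) (a : ℕ) :
    freq L (fun s => h + w s) g a = freq L w (g - h) a := by
  simp only [freq, eq_sub_iff_add_eq, add_comm h]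

lemma freq_eq_of_notMem_mixedBlocks {m L : ℕ} (hL : 0 < L) {w : ℕ → G} {a : ℕ} (ha : a < m)
    (h : a ∉ mixedBlocks m L w) (g : G) : freq L w g a = 0 ∨ freq L w g a = 1 := by
  have hw : ∀ r < L, w (a * L + r) = w (a * L) := by simpa [mixedBlocks, ha] using h
  have hL' : (L : ℝ) ≠ 0 := by positivity
  by_cases hg : w (a * L) = g
  · right
    rw [freq, Finset.filter_true_of_mem, Finset.card_range, div_self hL']
    intro r hr
    rw [hw r (Finset.mem_range.mp hr), hg]
  · left
    rw [freq, Finset.filter_false_of_mem]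
    · simp
    · intro r hr
      rwa [hw r (Finset.mem_range.mp hr)]

lemma sum_abs_freq_sub_le {m L : ℕ} {w w' : ℕ → G} {T : Finset ℕ}
    (h : ∀ s < m * L, s ∉ T → w s = w' s) (g : G) :
    ∑ a : Fin m, |freq L w g a - freq L w' g a| ≤ (T.card : ℝ) / L := by
  have h1 (a : Fin m) : |freq L w g a - freq L w' g a| ≤
      (((Finset.range L).filter fun r => a * L + r ∈ T).card : ℝ) / L := by
    rw [freq, freq, ← sub_div, abs_div, Nat.abs_cast]
    gcongr
    simp only [Finset.card_filter]
    push_cast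
    rw [← Finset.sum_sub_distrib]
    refine (Finset.abs_sum_le_sum_abs _ _).trans (Finset.sum_le_sum fun r hr => ?_)
    rw [Finset.mem_range] at hr
    by_cases hT : a * L + r ∈ T
    · rw [if_pos hT]
      split_ifs <;> norm_num
    · have : (a : ℕ) * L + L ≤ m * L := by nlinarith [a.isLt]
      rw [h _ (by omega) hT, if_neg hT, sub_self, abs_zero]
  refine (Finset.sum_le_sum fun a _ => h1 a).trans ?_
  rw [← Finset.sum_div]
  gcongr
  rw [← Nat.cast_sum, Nat.cast_le, ← Finset.card_sigma]
  refine Finset.card_le_card_of_injOn (fun x => x.1 * L + x.2) ?_ ?_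
  · rintro ⟨a, r⟩ hx
    simp only [Finset.coe_sigma, Set.mem_sigma_iff, Finset.mem_coe, Finset.mem_filter] at hx
    exact hx.2.2
  · rintro ⟨a, r⟩ hx ⟨b, s⟩ hy hxy
    simp only [Finset.coe_sigma, Set.mem_sigma_iff, Finset.mem_coe, Finset.mem_filter,
      Finset.mem_range] at hx hy hxy
    have hr := hx.2.1
    have hs := hy.2.1
    have hab : (a : ℕ) = b := by
      have ea : (a * L + r) / L = (a : ℕ) := by
        rw [mul_comm, Nat.mul_add_div (by omega), Nat.div_eq_of_lt hr, add_zero]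
      have eb : (b * L + s) / L = (b : ℕ) := by
        rw [mul_comm, Nat.mul_add_div (by omega), Nat.div_eq_of_lt hs, add_zero]
      rw [← ea, ← eb, hxy]
    obtain rfl := Fin.ext hab
    simp only [Sigma.mk.injEq, heq_eq_eq, true_and]
    omega

end Frequency

/-- Consensus division with few divided items: a prime power number of fractional parts on which
finitely many Lipschitz functions are approximately constant. -/
theorem exists_fractional_division {p ν : ℕ} [Fact p.Prime] {κ : Type*} [Fintype κ] {m : ℕ}
    (φ : κ → (Fin m → ℝ) → ℝ)
    (hφ : ∀ i x y, (∀ a, 0 ≤ x a ∧ x a ≤ 1) → (∀ a, 0 ≤ y a ∧ y a ≤ 1) →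
      |φ i x - φ i y| ≤ ∑ a, |x a - y a|) :
    ∃ x : (Fin ν → ZMod p) → Fin m → ℝ, (∀ g a, 0 ≤ x g a) ∧ (∀ a, ∑ g, x g a = 1) ∧
      (∃ S : Finset (Fin m),
        S.card ≤ 2 * (Fintype.card κ * (Fintype.card (Fin ν → ZMod p) - 1)) + 1 ∧
        ∀ a ∉ S, ∀ g, x g a = 0 ∨ x g a = 1) ∧
      ∀ i g g', |φ i (x g) - φ i (x g')| ≤ 1 := by
  set n := Fintype.card (Fin ν → ZMod p) with hn
  set N := 2 * (Fintype.card κ * (n - 1)) + 1 with hN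
  set L := 4 * (n * N) with hLdef
  have hn0 : 0 < n := Fintype.card_pos
  have hL : 0 < L := by positivity
  have hle (w : ℕ → Fin ν → ZMod p) (g : Fin ν → ZMod p) (a : ℕ) : freq L w g a ≤ 1 := by
    rw [← sum_freq hL w a]
    exact Finset.single_le_sum (f := fun g => freq L w g a) (fun g _ => freq_nonneg _ _ _ _)
      (Finset.mem_univ g)
  let f (i : κ) (w : ℕ → Fin ν → ZMod p) (g : Fin ν → ZMod p) : ℂ :=
    (φ i (fun a => freq L w g a) : ℝ)
  obtain ⟨l, ⟨⟨T, hT, hlT⟩, hmix⟩, hlen, hsmall⟩ := exists_isFine_norm_le (p := p) (ν := ν) m L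
    (ι := κ × {y : Fin ν → ZMod p // y ≠ 0}) (fun q => dot q.2.1)
    (fun q h => by
      obtain ⟨g, hg⟩ := exists_dot_ne_zero q.2.2
      exact hg (by rw [h]; rfl))
    (fun q w => fourier (f q.1 w) q.2.1)
    (fun q h w => by
      simp only [fourier, f, freq_add, Finset.mul_sum]
      rw [← Equiv.sum_comp (Equiv.addLeft h)]
      refine Finset.sum_congr rfl fun g _ => ?_
      simp only [Equiv.coe_addLeft, add_sub_cancel_left, map_add, AddChar.map_add_eq_mul]
      ring)
  have hcard : Fintype.card {y : Fin ν → ZMod p // y ≠ 0} = n - 1 := by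
    rw [Fintype.card_subtype_compl, Fintype.card_subtype_eq]
  rw [Fintype.card_prod, hcard] at hlen
  have hclose : ∀ w ∈ l, ∀ w' ∈ l, ∀ i y, ‖fourier (f i w) y - fourier (f i w') y‖ ≤ 1 / 4 := by
    intro w hw w' hw' i y
    have hTL : (T.card : ℝ) / L ≤ N / L := by
      gcongr
      omega
    have e : (1 / 4 : ℝ) = (Finset.univ : Finset (Fin ν → ZMod p)).card • ((N : ℝ) / L) := by
      have hN0 : (0 : ℝ) < N := by rw [hN]; positivity
      rw [Finset.card_univ, ← hn, nsmul_eq_mul, hLdef]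
      push_cast
      field_simp
    simp only [fourier]
    rw [← Finset.sum_sub_distrib, e]
    refine (norm_sum_le _ _).trans (Finset.sum_le_card_nsmul _ _ _ fun g _ => ?_)
    rw [← mul_sub, norm_mul, AddChar.norm_apply, one_mul]
    simp only [f]
    rw [← Complex.ofReal_sub, Complex.norm_real, Real.norm_eq_abs]
    exact ((hφ i _ _ (fun a => ⟨freq_nonneg _ _ _ _, hle _ _ _⟩)
      (fun a => ⟨freq_nonneg _ _ _ _, hle _ _ _⟩)).trans
      (sum_abs_freq_sub_le (fun s hs hsT => hlT w hw w' hw' s hs hsT) g)).trans hTL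
  obtain ⟨w, hw⟩ := List.exists_mem_of_length_pos (l := l) (by omega)
  refine ⟨fun g a => freq L w g a, fun g a => freq_nonneg _ _ _ _, fun a => sum_freq hL w a,
    ⟨Finset.univ.filter fun a : Fin m => (a : ℕ) ∈ mixedBlocks m L w, ?_, ?_⟩, ?_⟩
  · refine le_trans ?_ ((hmix w hw).trans hlen.le)
    refine Finset.card_le_card_of_injOn (fun a => (a : ℕ)) (fun a ha => ?_)
      Fin.val_injective.injOn
    simpa using ha
  · intro a ha g
    exact freq_eq_of_notMem_mixedBlocks hL a.isLt (by simpa using ha) g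
  · intro i g g'
    have hy : ∀ y, y ≠ 0 → ‖fourier (f i w) y‖ ≤ 1 / 2 := by
      intro y hy
      obtain ⟨a, ha, b, hb, hab⟩ := hsmall (i, ⟨y, hy⟩)
      have h1 := hclose a ha b hb i y
      have h2 := hclose w hw a ha i y
      have h3 := norm_le_norm_add_norm_sub' (fourier (f i w) y) (fourier (f i a) y)
      simp only at hab
      linarith
    have := norm_sub_le_of_fourier_le (by norm_num) hy g g'
    simp only [f] at this
    rw [← Complex.ofReal_sub, Complex.norm_real, Real.norm_eq_abs] at this
    linarith

section Multilinear

variable {ι : Type*} [DecidableEq ι]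

/-- The expected value of a set function at a random subset of `s` that contains each element `a`
independently with probability `z a`. -/
noncomputable def mean (z : ι → ℝ) (s : Finset ι) (f : Finset ι → ℝ) : ℝ :=
  ∑ S ∈ s.powerset, (∏ a ∈ s, if a ∈ S then z a else 1 - z a) * f S

lemma mean_empty (z : ι → ℝ) (f : Finset ι → ℝ) : mean z ∅ f = f ∅ := by simp [mean]

lemma mean_add (z : ι → ℝ) (s : Finset ι) (f f' : Finset ι → ℝ) :
    mean z s (fun S => f S + f' S) = mean z s f + mean z s f' := by
  simp [mean, mul_add, Finset.sum_add_distrib]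

lemma mean_const_mul (z : ι → ℝ) (s : Finset ι) (c : ℝ) (f : Finset ι → ℝ) :
    mean z s (fun S => c * f S) = c * mean z s f := by
  simp only [mean, Finset.mul_sum]
  exact Finset.sum_congr rfl fun S _ => by ring

lemma mean_insert (z : ι → ℝ) {s : Finset ι} {a : ι} (ha : a ∉ s) (f : Finset ι → ℝ) :
    mean z (insert a s) f = mean z s fun S => z a * f (insert a S) + (1 - z a) * f S := by
  rw [mean, Finset.sum_powerset_insert ha, mean, ← Finset.sum_add_distrib]
  refine Finset.sum_congr rfl fun S hS => ?_
  rw [Finset.mem_powerset] at hS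
  have haS : a ∉ S := fun h => ha (hS h)
  rw [Finset.prod_insert ha, Finset.prod_insert ha, if_neg haS,
    if_pos (Finset.mem_insert_self a S)]
  have : ∏ b ∈ s, (if b ∈ insert a S then z b else 1 - z b) =
      ∏ b ∈ s, if b ∈ S then z b else 1 - z b := by
    refine Finset.prod_congr rfl fun b hb => ?_
    have : b ≠ a := fun h => ha (h ▸ hb)
    simp [this]
  rw [this]
  ring

lemma mean_const (z : ι → ℝ) (s : Finset ι) (c : ℝ) : mean z s (fun _ => c) = c := by
  induction s using Finset.induction_on with
  | empty => exact mean_empty _ _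
  | insert a s ha ih =>
    rw [mean_insert z ha]
    simpa [← add_mul] using ih

lemma mean_mono {z : ι → ℝ} (hz : ∀ a, 0 ≤ z a ∧ z a ≤ 1) (s : Finset ι) {f f' : Finset ι → ℝ}
    (h : ∀ S, f S ≤ f' S) : mean z s f ≤ mean z s f' := by
  refine Finset.sum_le_sum fun S _ => mul_le_mul_of_nonneg_left (h S) ?_
  refine Finset.prod_nonneg fun a _ => ?_
  split_ifs
  · exact (hz a).1
  · exact sub_nonneg.mpr (hz a).2

/-- A set function has marginals bounded by one. -/
def BoundedMarginals (v : Finset ι → ℝ) : Prop := ∀ S a, |v (insert a S) - v S| ≤ 1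

lemma BoundedMarginals.average {v : Finset ι → ℝ} (hv : BoundedMarginals v) (a : ι) {t : ℝ}
    (ht : 0 ≤ t ∧ t ≤ 1) : BoundedMarginals fun S => t * v (insert a S) + (1 - t) * v S := by
  intro S b
  have h1 := abs_le.mp (hv (insert a S) b)
  have h2 := abs_le.mp (hv S b)
  rw [Finset.insert_comm b a] at h1
  rw [abs_le]
  constructor <;> nlinarith [h1.1, h1.2, h2.1, h2.2, ht.1, ht.2]

lemma BoundedMarginals.abs_mean_sub_le {v : Finset ι → ℝ} (hv : BoundedMarginals v)
    {z z' : ι → ℝ} (hz : ∀ a, 0 ≤ z a ∧ z a ≤ 1) (hz' : ∀ a, 0 ≤ z' a ∧ z' a ≤ 1)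
    (s : Finset ι) : |mean z s v - mean z' s v| ≤ ∑ a ∈ s, |z a - z' a| := by
  induction s using Finset.induction_on generalizing v with
  | empty => simp [mean_empty]
  | insert a s ha ih =>
    rw [mean_insert z ha, mean_insert z' ha, Finset.sum_insert ha]
    have h1 := ih (hv.average a (hz a))
    have h2 : mean z' s (fun S => z a * v (insert a S) + (1 - z a) * v S) =
        mean z' s (fun S => z' a * v (insert a S) + (1 - z' a) * v S) +
        (z a - z' a) * mean z' s (fun S => v (insert a S) - v S) := by
      rw [← mean_const_mul, ← mean_add]
      congr 1
      ext S
      ring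
    have h3 : |mean z' s (fun S => v (insert a S) - v S)| ≤ 1 := by
      rw [abs_le]
      constructor
      · rw [← mean_const z' s (-1)]
        exact mean_mono hz' s fun S => (abs_le.mp (hv S a)).1
      · conv_rhs => rw [← mean_const z' s 1]
        exact mean_mono hz' s fun S => (abs_le.mp (hv S a)).2
    have h4 : |(z a - z' a) * mean z' s (fun S => v (insert a S) - v S)| ≤ |z a - z' a| := by
      rw [abs_mul]
      exact mul_le_of_le_one_right (abs_nonneg _) h3
    rw [h2] at h1
    rw [abs_le] at h1 h4 ⊢
    constructor <;> linarith [h1.1, h1.2, h4.1, h4.2]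

lemma two_point_mgf {l d t : ℝ} (hl : |l| ≤ 1) (hd : |d| ≤ 1) (ht : 0 ≤ t ∧ t ≤ 1) :
    t * Real.exp (l * ((1 - t) * d)) + (1 - t) * Real.exp (l * (-t * d)) ≤
      Real.exp (l ^ 2 * (t * (1 - t))) := by
  obtain ⟨ht0, ht1⟩ := ht
  have hld : |l * d| ≤ 1 := by
    rw [abs_mul]
    exact mul_le_one₀ hl (abs_nonneg _) hd
  have hbound {y : ℝ} (hy : |y| ≤ 1) : Real.exp y ≤ 1 + y + y ^ 2 := by
    have := (abs_le.mp (Real.abs_exp_sub_one_sub_id_le hy)).2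
    linarith
  have h1 : |l * ((1 - t) * d)| ≤ 1 := by
    rw [show l * ((1 - t) * d) = (1 - t) * (l * d) by ring, abs_mul]
    exact mul_le_one₀ (by rw [abs_le]; constructor <;> linarith) (abs_nonneg _) hld
  have h2 : |l * (-t * d)| ≤ 1 := by
    rw [show l * (-t * d) = -t * (l * d) by ring, abs_mul]
    exact mul_le_one₀ (by rw [abs_le]; constructor <;> linarith) (abs_nonneg _) hld
  have h3 := mul_le_mul_of_nonneg_left (hbound h1) ht0
  have h4 := mul_le_mul_of_nonneg_left (hbound h2) (sub_nonneg.mpr ht1)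
  have h5 := Real.add_one_le_exp (l ^ 2 * (t * (1 - t)))
  have h6 : d ^ 2 ≤ 1 := (sq_le_one_iff_abs_le_one d).mpr hd
  have h7 : l ^ 2 * (t * (1 - t)) * d ^ 2 ≤ l ^ 2 * (t * (1 - t)) :=
    mul_le_of_le_one_right
      (mul_nonneg (sq_nonneg l) (mul_nonneg ht0 (sub_nonneg.mpr ht1))) h6
  nlinarith

lemma BoundedMarginals.mgf_le {v : Finset ι → ℝ} (hv : BoundedMarginals v)
    {z : ι → ℝ} (hz : ∀ a, 0 ≤ z a ∧ z a ≤ 1) {l : ℝ} (hl : |l| ≤ 1) (s : Finset ι) :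
    mean z s (fun S => Real.exp (l * v S)) ≤
      Real.exp (l * mean z s v + l ^ 2 * ∑ a ∈ s, z a * (1 - z a)) := by
  induction s using Finset.induction_on generalizing v with
  | empty => simp [mean_empty]
  | insert a s ha ih =>
    rw [mean_insert z ha, mean_insert z ha, Finset.sum_insert ha]
    have h1 := ih (hv.average a (hz a))
    have h2 : mean z s (fun S => z a * Real.exp (l * v (insert a S)) +
        (1 - z a) * Real.exp (l * v S)) ≤
        mean z s (fun S => Real.exp (l ^ 2 * (z a * (1 - z a))) *
          Real.exp (l * (z a * v (insert a S) + (1 - z a) * v S))) := by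
      refine mean_mono hz s fun S => ?_
      have h3 := two_point_mgf hl (hv S a) (hz a)
      have h4 := mul_le_mul_of_nonneg_right h3
        (Real.exp_pos (l * (z a * v (insert a S) + (1 - z a) * v S))).le
      refine le_trans (le_of_eq ?_) h4
      rw [add_mul, mul_assoc, mul_assoc, ← Real.exp_add, ← Real.exp_add]
      congr 3 <;> ring_nf
    rw [mean_const_mul] at h2
    refine h2.trans ((mul_le_mul_of_nonneg_left h1 (Real.exp_pos _).le).trans_eq ?_)
    rw [← Real.exp_add]
    ring_nf

/-- The probability of an independent random assignment of items to parts. -/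
noncomputable def assignProb {G : Type*} [Fintype ι] (x : G → ι → ℝ) (σ : ι → G) : ℝ :=
  ∏ a, x (σ a) a

lemma sum_assignProb {G : Type*} [Fintype G] [DecidableEq G] [Fintype ι] {x : G → ι → ℝ}
    (hx : ∀ a, ∑ g, x g a = 1) (g : G) (f : Finset ι → ℝ) :
    ∑ σ : ι → G, assignProb x σ * f {a | σ a = g} = mean (x g) Finset.univ f := by
  rw [mean, Finset.powerset_univ,
    ← Finset.sum_fiberwise Finset.univ (fun σ : ι → G => ({a | σ a = g} : Finset ι))]
  refine Finset.sum_congr rfl fun S _ => ?_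
  have h1 : ∏ a, (if a ∈ S then x g a else 1 - x g a) =
      ∏ a, ∑ h ∈ (if a ∈ S then {g} else Finset.univ.erase g), x h a := by
    refine Finset.prod_congr rfl fun a _ => ?_
    split_ifs
    · simp
    · rw [← hx a, ← Finset.add_sum_erase _ _ (Finset.mem_univ g)]
      ring
  rw [h1, Finset.prod_univ_sum, Finset.sum_mul]
  have h2 : Fintype.piFinset (fun a => if a ∈ S then {g} else Finset.univ.erase g) =
      Finset.univ.filter fun σ : ι → G => ({a | σ a = g} : Finset ι) = S := by
    ext σ
    simp only [Fintype.mem_piFinset, Finset.mem_filter, Finset.mem_univ, true_and, Finset.ext_iff]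
    refine forall_congr' fun a => ?_
    by_cases ha : a ∈ S <;> simp [ha]
  rw [h2]
  refine Finset.sum_congr rfl fun σ hσ => ?_
  rw [(Finset.mem_filter.mp hσ).2, assignProb]

/-- Independent rounding of a fractional division. -/
lemma exists_rounding {G K : Type*} [Fintype G] [DecidableEq G] [Fintype K] [Fintype ι]
    {x : G → ι → ℝ} (hx0 : ∀ g a, 0 ≤ x g a) (hx : ∀ a, ∑ g, x g a = 1)
    {v : K → Finset ι → ℝ} (hv : ∀ i, BoundedMarginals (v i)) {V l : ℝ}
    (hV : ∀ g, ∑ a, x g a * (1 - x g a) ≤ V) (hl0 : 0 < l) (hl : l ≤ 1) :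
    ∃ σ : ι → G, ∀ i g, Real.exp (l * |v i {a | σ a = g} - mean (x g) Finset.univ (v i)|) ≤
      2 * (Fintype.card K * Fintype.card G) * Real.exp (l ^ 2 * V) := by
  have hz (g : G) (a : ι) : 0 ≤ x g a ∧ x g a ≤ 1 := by
    refine ⟨hx0 g a, ?_⟩
    rw [← hx a]
    exact Finset.single_le_sum (f := fun g => x g a) (fun g _ => hx0 g a) (Finset.mem_univ g)
  let H (σ : ι → G) (i : K) (g : G) (r : ℝ) : ℝ :=
    Real.exp (r * (v i {a | σ a = g} - mean (x g) Finset.univ (v i)))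
  have hmgf (i : K) (g : G) {r : ℝ} (hr : |r| ≤ 1) :
      ∑ σ, assignProb x σ * H σ i g r ≤ Real.exp (r ^ 2 * V) := by
    simp only [H]
    rw [sum_assignProb hx g fun S => Real.exp (r * (v i S - mean (x g) Finset.univ (v i)))]
    have e : (fun S => Real.exp (r * (v i S - mean (x g) Finset.univ (v i)))) =
        fun S => Real.exp (-(r * mean (x g) Finset.univ (v i))) * Real.exp (r * v i S) := by
      ext S
      rw [← Real.exp_add]
      ring_nf
    rw [e, mean_const_mul]
    refine (mul_le_mul_of_nonneg_left ((hv i).mgf_le (hz g) hr Finset.univ)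
      (Real.exp_pos _).le).trans ?_
    rw [← Real.exp_add]
    refine Real.exp_le_exp.mpr ?_
    have := mul_le_mul_of_nonneg_left (hV g) (sq_nonneg r)
    linarith
  have hl' : |l| ≤ 1 := by rwa [abs_of_pos hl0]
  have htotal : ∑ σ, assignProb x σ * ∑ i, ∑ g, (H σ i g l + H σ i g (-l)) ≤
      2 * (Fintype.card K * Fintype.card G) * Real.exp (l ^ 2 * V) := by
    have e : ∑ σ, assignProb x σ * ∑ i, ∑ g, (H σ i g l + H σ i g (-l)) =
        ∑ i, ∑ g, (∑ σ, assignProb x σ * H σ i g l + ∑ σ, assignProb x σ * H σ i g (-l)) := by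
      simp only [Finset.mul_sum, mul_add, ← Finset.sum_add_distrib]
      rw [Finset.sum_comm]
      exact Finset.sum_congr rfl fun i _ => Finset.sum_comm
    rw [e]
    have h1 : ∀ i g, ∑ σ, assignProb x σ * H σ i g l + ∑ σ, assignProb x σ * H σ i g (-l) ≤
        2 * Real.exp (l ^ 2 * V) := by
      intro i g
      have h2 := hmgf i g hl'
      have h3 := hmgf i g (r := -l) (by rwa [abs_neg])
      rw [neg_sq] at h3
      linarith
    refine (Finset.sum_le_sum fun i _ => Finset.sum_le_sum fun g _ => h1 i g).trans_eq ?_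
    simp only [Finset.sum_const, Finset.card_univ, nsmul_eq_mul]
    ring
  have hprob : ∑ σ, assignProb x σ = 1 := by
    have := Finset.prod_univ_sum (fun _ : ι => (Finset.univ : Finset G)) fun a g => x g a
    simp only [hx, Finset.prod_const_one, Fintype.piFinset_univ] at this
    exact this.symm
  have hprob0 (σ : ι → G) : 0 ≤ assignProb x σ := Finset.prod_nonneg fun a _ => hx0 _ _
  obtain ⟨σ, hσ⟩ : ∃ σ : ι → G, ∑ i, ∑ g, (H σ i g l + H σ i g (-l)) ≤
      2 * (Fintype.card K * Fintype.card G) * Real.exp (l ^ 2 * V) := by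
    by_contra! hcon
    obtain ⟨σ₀, -, hσ₀⟩ : ∃ σ ∈ Finset.univ, 0 < assignProb x σ :=
      Finset.exists_lt_of_sum_lt (f := fun _ => 0) (by simp [hprob])
    refine absurd htotal (not_le.mpr ?_)
    rw [← one_mul (2 * _ * _), ← hprob, Finset.sum_mul]
    exact Finset.sum_lt_sum (fun σ _ => mul_le_mul_of_nonneg_left (hcon σ).le (hprob0 σ))
      ⟨σ₀, Finset.mem_univ _, mul_lt_mul_of_pos_left (hcon σ₀) hσ₀⟩
  refine ⟨σ, fun i g => le_trans ?_ hσ⟩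
  have hpos (i : K) (g : G) : 0 ≤ H σ i g l + H σ i g (-l) :=
    add_nonneg (Real.exp_pos _).le (Real.exp_pos _).le
  refine le_trans ?_ (Finset.single_le_sum (f := fun i => ∑ g, (H σ i g l + H σ i g (-l)))
    (fun i _ => Finset.sum_nonneg fun g _ => hpos i g) (Finset.mem_univ i))
  refine le_trans ?_ (Finset.single_le_sum (f := fun g => H σ i g l + H σ i g (-l))
    (fun g _ => hpos i g) (Finset.mem_univ g))
  simp only [H]
  rcases abs_choice (v i {a | σ a = g} - mean (x g) Finset.univ (v i)) with h | h
  · rw [h]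
    linarith [Real.exp_pos (-l * (v i {a | σ a = g} - mean (x g) Finset.univ (v i)))]
  · rw [h, mul_neg, ← neg_mul]
    linarith [Real.exp_pos (l * (v i {a | σ a = g} - mean (x g) Finset.univ (v i)))]

end Multilinear

section Division

variable {p ν m : ℕ} [Fact p.Prime]

lemma abs_sum_variance_sub_le {z z' : Fin m → ℝ} (hz : ∀ a, 0 ≤ z a ∧ z a ≤ 1)
    (hz' : ∀ a, 0 ≤ z' a ∧ z' a ≤ 1) :
    |∑ a, z a * (1 - z a) - ∑ a, z' a * (1 - z' a)| ≤ ∑ a, |z a - z' a| := by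
  rw [← Finset.sum_sub_distrib]
  refine (Finset.abs_sum_le_sum_abs _ _).trans (Finset.sum_le_sum fun a _ => ?_)
  rw [show z a * (1 - z a) - z' a * (1 - z' a) = (z a - z' a) * (1 - z a - z' a) by ring, abs_mul]
  refine mul_le_of_le_one_right (abs_nonneg _) ?_
  rw [abs_le]
  constructor <;> linarith [(hz a).1, (hz a).2, (hz' a).1, (hz' a).2]

/-- A fractional division into a prime power number of parts that is nearly fair for as many
agents and has small variance in each part. -/
lemma exists_fractional_division_variance_le {K : Type*} [Fintype K]
    (hK : Fintype.card K = Fintype.card (Fin ν → ZMod p))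
    {v : K → Finset (Fin m) → ℝ} (hv : ∀ i, BoundedMarginals (v i)) :
    ∃ x : (Fin ν → ZMod p) → Fin m → ℝ, (∀ g a, 0 ≤ x g a) ∧ (∀ a, ∑ g, x g a = 1) ∧
      (∀ g, ∑ a, x g a * (1 - x g a) ≤ 3 * Fintype.card K) ∧
      ∀ i g g', |mean (x g) Finset.univ (v i) - mean (x g') Finset.univ (v i)| ≤ 1 := by
  let φ : Option K → (Fin m → ℝ) → ℝ := fun i z =>
    i.elim (∑ a, z a * (1 - z a)) fun i => mean z Finset.univ (v i)
  obtain ⟨x, hx0, hx, ⟨S, hS, hxS⟩, hφ⟩ := exists_fractional_division (p := p) (ν := ν) φ (by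
    rintro (_ | i) z z' hz hz'
    · exact abs_sum_variance_sub_le hz hz'
    · exact (hv i).abs_mean_sub_le hz hz' Finset.univ)
  refine ⟨x, hx0, hx, fun g => ?_, fun i => hφ (some i)⟩
  have hsum : ∑ g, ∑ a, x g a * (1 - x g a) ≤ S.card := by
    rw [Finset.sum_comm]
    have h1 : ∀ a, ∑ g, x g a * (1 - x g a) ≤ if a ∈ S then 1 else 0 := by
      intro a
      split_ifs with ha
      · refine (Finset.sum_le_sum fun g _ => ?_).trans_eq (hx a)
        nlinarith [hx0 g a]
      · refine (Finset.sum_eq_zero fun g _ => ?_).le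
        rcases hxS a ha g with h | h <;> simp [h]
    exact (Finset.sum_le_sum fun a _ => h1 a).trans_eq (by simp)
  have hn : 0 < Fintype.card (Fin ν → ZMod p) := Fintype.card_pos
  rw [Fintype.card_option, hK] at hS
  rw [hK]
  have hS' : (S.card : ℝ) ≤
      2 * (Fintype.card (Fin ν → ZMod p) : ℝ) ^ 2 := by
    obtain ⟨k, hk⟩ := Nat.exists_eq_add_of_lt hn
    rw [hk] at hS ⊢
    refine (Nat.cast_le.mpr hS).trans ?_
    push_cast [Nat.add_sub_cancel]
    nlinarith
  have hcard := Finset.sum_le_sum (s := Finset.univ) fun g' _ =>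
    sub_le_iff_le_add.mp ((le_abs_self _).trans (hφ none g g'))
  simp only [Finset.sum_add_distrib, Finset.sum_const, Finset.card_univ, nsmul_eq_mul, φ,
    Option.elim_none] at hcard
  have hn' : (0 : ℝ) < Fintype.card (Fin ν → ZMod p) := by exact_mod_cast hn
  have hn1 : (1 : ℝ) ≤ Fintype.card (Fin ν → ZMod p) := by exact_mod_cast hn
  refine le_of_mul_le_mul_left ?_ hn'
  nlinarith

/-- A prime power number of agents can divide the items into bundles between which every agent is
nearly indifferent. -/
lemma exists_division {K : Type*} [Fintype K]
    (hK : Fintype.card K = Fintype.card (Fin ν → ZMod p)) (hK2 : 2 ≤ Fintype.card K)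
    {v : K → Finset (Fin m) → ℝ} (hv : ∀ i, BoundedMarginals (v i)) :
    ∃ σ : Fin m → Fin ν → ZMod p, ∀ i g g', |v i {a | σ a = g} - v i {a | σ a = g'}| ≤
      13 * Real.sqrt (Fintype.card K * Real.log (Fintype.card K)) := by
  obtain ⟨x, hx0, hx, hV, hφ⟩ := exists_fractional_division_variance_le hK hv
  set n : ℝ := (Fintype.card K : ℝ) with hn
  have hn2 : 2 ≤ n := by rw [hn]; exact_mod_cast hK2
  have hn0 : 0 < n := by linarith
  have hL : Real.log 2 ≤ Real.log n := Real.log_le_log two_pos hn2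
  have hL2 := Real.log_two_gt_d9
  have hL0 : 0 < Real.log n := by linarith
  set R := Real.sqrt (n * Real.log n) with hR
  have hRsq : R ^ 2 = n * Real.log n := Real.sq_sqrt (by positivity)
  have hR1 : 1 ≤ R := Real.one_le_sqrt.mpr (by nlinarith)
  have hR0 : 0 < R := by linarith
  have hRn : R ≤ n := by
    refine Real.sqrt_le_iff.mpr ⟨hn0.le, ?_⟩
    nlinarith [Real.log_le_self hn0.le]
  obtain ⟨σ, hσ⟩ := exists_rounding hx0 hx hv hV (div_pos hR0 hn0) ((div_le_one hn0).mpr hRn)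
  have hdev (i g) : |v i {a | σ a = g} - mean (x g) Finset.univ (v i)| ≤ 6 * R := by
    have h := Real.log_le_log (Real.exp_pos _) (hσ i g)
    rw [← hK, ← hn, Real.log_exp, Real.log_mul (by positivity) (by positivity), Real.log_exp,
      Real.log_mul (by positivity) (by positivity), Real.log_mul (by positivity) (by positivity),
      div_pow, hRsq] at h
    have e : n * Real.log n / n ^ 2 * (3 * n) = 3 * Real.log n := by field_simp
    have e' : R / n * (6 * R) = 6 * Real.log n := by
      rw [show R / n * (6 * R) = 6 * R ^ 2 / n by ring, hRsq]
      field_simp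
    rw [e] at h
    refine le_of_mul_le_mul_left (a := R / n) ?_ (div_pos hR0 hn0)
    rw [e']
    linarith
  refine ⟨σ, fun i g g' => ?_⟩
  have h1 := abs_le.mp (hdev i g)
  have h2 := abs_le.mp (hdev i g')
  have h3 := abs_le.mp (hφ i g g')
  rw [abs_le]
  constructor <;> linarith [h1.1, h1.2, h2.1, h2.2, h3.1, h3.2]

end Division

section Payments

variable {V : Type*} [Fintype V] [DecidableEq V]

/-- Edge weights for which no permutation has positive weight have no closed walk of positive
weight. -/
lemma sum_closed_walk_nonpos {c : V → V → ℝ} (hc0 : ∀ i, c i i = 0)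
    (hc : ∀ τ : Equiv.Perm V, ∑ i, c i (τ i) ≤ 0) {f : ℕ → V} {k : ℕ} (hf : f k = f 0) :
    ∑ t ∈ Finset.range k, c (f t) (f (t + 1)) ≤ 0 := by
  rcases k.eq_zero_or_pos with rfl | hk
  · simp
  let r : V → ℝ := fun i => ∑ t ∈ Finset.range k, if f t = i then 1 else 0
  have hr (j : V) : ∑ t ∈ Finset.range k, (if f (t + 1) = j then 1 else 0) = r j := by
    have h := Finset.sum_range_succ' (fun t => if f t = j then (1 : ℝ) else 0) k
    rw [Finset.sum_range_succ, hf] at h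
    exact (add_right_cancel h).symm
  have hrk (i : V) : r i ≤ k := by
    refine (Finset.sum_le_sum fun t _ => ?_ : _ ≤ ∑ t ∈ Finset.range k, (1 : ℝ)).trans (by simp)
    split_ifs <;> norm_num
  let N : Matrix V V ℝ := fun i j =>
    (∑ t ∈ Finset.range k, if f t = i ∧ f (t + 1) = j then 1 else 0) +
      if i = j then k - r i else 0
  have hN0 (i j : V) : 0 ≤ N i j := by
    refine add_nonneg (Finset.sum_nonneg fun t _ => ?_) ?_
    · split_ifs <;> norm_num
    · split_ifs
      · exact sub_nonneg.mpr (hrk i)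
      · rfl
  have hNrow (i : V) : ∑ j, N i j = k := by
    simp only [N, Finset.sum_add_distrib, ite_and]
    rw [Finset.sum_comm]
    simp only [Finset.sum_ite_irrel, Finset.sum_ite_eq, Finset.mem_univ, if_true,
      Finset.sum_const_zero]
    simp [r]
  have hNcol (j : V) : ∑ i, N i j = k := by
    have hN (i : V) : N i j = (∑ t ∈ Finset.range k,
        if f (t + 1) = j then if f t = i then 1 else 0 else 0) + if i = j then k - r i else 0 := by
      simp only [N, ← ite_and, and_comm]
    simp only [hN, Finset.sum_add_distrib]
    rw [Finset.sum_comm]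
    simp only [Finset.sum_ite_irrel, Finset.sum_ite_eq, Finset.sum_ite_eq', Finset.mem_univ,
      if_true, Finset.sum_const_zero]
    rw [hr]
    ring
  obtain ⟨D, hD, hND⟩ := (exists_mem_doublyStochastic_eq_smul_iff (M := N)
    (Nat.cast_nonneg k)).mpr ⟨hN0, hNrow, hNcol⟩
  obtain ⟨u, hu0, -, hu⟩ := exists_eq_sum_perm_of_mem_doublyStochastic hD
  have hsum : ∑ t ∈ Finset.range k, c (f t) (f (t + 1)) = ∑ i, ∑ j, N i j * c i j := by
    simp only [N, add_mul, Finset.sum_mul, Finset.sum_add_distrib, ite_mul, one_mul, zero_mul,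
      Finset.sum_ite_eq, Finset.mem_univ, if_true, hc0, mul_zero, add_zero]
    rw [Finset.sum_congr rfl fun i _ => Finset.sum_comm, Finset.sum_comm]
    simp only [ite_and, Finset.sum_ite_irrel, Finset.sum_ite_eq, Finset.mem_univ, if_true,
      Finset.sum_const_zero]
  have hperm : ∑ i, ∑ j, N i j * c i j = k * ∑ τ, u τ * ∑ i, c i (τ i) := by
    rw [hND, ← hu]
    simp only [Matrix.smul_apply, Matrix.sum_apply, Finset.mul_sum, Finset.sum_mul, smul_eq_mul]
    rw [Finset.sum_congr rfl fun i _ => Finset.sum_comm, Finset.sum_comm]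
    refine Finset.sum_congr rfl fun τ _ => Finset.sum_congr rfl fun i _ => ?_
    simp [Equiv.Perm.permMatrix, PEquiv.toMatrix_apply, Equiv.toPEquiv_apply, mul_assoc]
  rw [hsum, hperm]
  exact mul_nonpos_of_nonneg_of_nonpos (Nat.cast_nonneg k)
    (Finset.sum_nonpos fun τ _ => mul_nonpos_of_nonneg_of_nonpos (hu0 τ) (hc τ))

/-- If every agent values any two bundles almost equally, the bundles can be assigned to the agents
with small payments that remove all envy. -/
lemma exists_perm_payments {w : V → V → ℝ} {E : ℝ} (hw : ∀ i j j', |w i j - w i j'| ≤ E) :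
    ∃ (π : Equiv.Perm V) (q : V → ℝ), (∀ i, 0 ≤ q i) ∧ (∀ i, q i ≤ E) ∧
      ∀ i j, w i (π j) + q j ≤ w i (π i) + q i := by
  obtain ⟨π, hπ⟩ := Finite.exists_max fun π : Equiv.Perm V => ∑ i, w i (π i)
  let c : V → V → ℝ := fun i j => w i (π j) - w i (π i)
  let W : (ℕ → V) → ℕ → ℝ := fun f k => ∑ t ∈ Finset.range k, c (f t) (f (t + 1))
  have hclosed {f : ℕ → V} {k : ℕ} (hf : f k = f 0) : W f k ≤ 0 := by
    refine sum_closed_walk_nonpos (c := c) (fun i => sub_self _) (fun τ => ?_) hf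
    simp only [c, Finset.sum_sub_distrib]
    exact sub_nonpos.mpr (hπ (τ.trans π))
  have hbound (f : ℕ → V) (k : ℕ) : W f k ≤ E := by
    let f' : ℕ → V := fun t => if t ≤ k then f t else f 0
    have h : W f' (k + 1) ≤ 0 := hclosed (by simp [f'])
    have e : W f' (k + 1) = W f k + c (f k) (f 0) := by
      simp only [W]
      rw [Finset.sum_range_succ]
      congr 1
      · refine Finset.sum_congr rfl fun t ht => ?_
        rw [Finset.mem_range] at ht
        simp [f', ht.le, Nat.succ_le_of_lt ht]
      · simp [f']
    have := (abs_le.mp (hw (f k) (π (f 0)) (π (f k)))).1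
    simp only [e, c] at h
    linarith
  let s : V → Set ℝ := fun i => {y | ∃ f k, f 0 = i ∧ W f k = y}
  have hs (i : V) : BddAbove (s i) := ⟨E, by rintro _ ⟨f, k, -, rfl⟩; exact hbound f k⟩
  have hs0 (i : V) : (0 : ℝ) ∈ s i := ⟨fun _ => i, 0, rfl, by simp [W]⟩
  refine ⟨π, fun i => sSup (s i), fun i => le_csSup (hs i) (hs0 i), fun i => csSup_le ⟨0, hs0 i⟩ ?_,
    fun i j => ?_⟩
  · rintro _ ⟨f, k, -, rfl⟩
    exact hbound f k
  · have : sSup (s j) ≤ sSup (s i) - c i j := by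
      refine csSup_le ⟨0, hs0 j⟩ ?_
      rintro _ ⟨f, k, hf, rfl⟩
      rw [le_sub_iff_add_le]
      refine le_csSup (hs i) ⟨fun t => t.casesOn i f, k + 1, rfl, ?_⟩
      simp only [W]
      rw [Finset.sum_range_succ']
      simp [hf]
    simp only [c] at this
    linarith

end Payments

end EnvyFreeSubsidy

/-- **Subquadratic total subsidy for a prime-power number of agents.**
There is a universal constant `C > 0` such that whenever the number of agents
`n = p ^ ν ≥ 2` is a prime power and the `n` (arbitrary, not necessarily
monotone) valuations have marginals bounded by `1`, there exist an allocation
`A` and a nonnegative payment vector `q` making `(A, q)` envy-free with total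
subsidy `∑ i, q i ≤ C * n * √(n * log n)`. -/
theorem envy_free_subsidy_prime_power :
    ∃ C : ℝ, 0 < C ∧
      ∀ (p ν n : ℕ), p.Prime → 1 ≤ ν → n = p ^ ν → 2 ≤ n →
      ∀ (α : Type) [Fintype α] [DecidableEq α]
        (v : Fin n → Finset α → ℝ),
        (∀ (i : Fin n) (S : Finset α) (j : α), |v i (insert j S) - v i S| ≤ 1) →
        ∃ (A : Fin n → Finset α) (q : Fin n → ℝ),
          (∀ i j : Fin n, i ≠ j → Disjoint (A i) (A j)) ∧
          (∀ x : α, ∃ i : Fin n, x ∈ A i) ∧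
          (∀ i, 0 ≤ q i) ∧
          (∀ i j : Fin n, v i (A j) + q j ≤ v i (A i) + q i) ∧
          ∑ i, q i ≤ C * n * Real.sqrt (n * Real.log n) := by
  refine ⟨13, by norm_num, fun p ν n hp _ hn hn2 α _ _ v hv => ?_⟩
  have : Fact p.Prime := ⟨hp⟩
  have hcard : Fintype.card (Fin n) = Fintype.card (Fin ν → ZMod p) := by
    simp [hn, ZMod.card]
  let e := Fintype.equivFin α
  obtain ⟨σ, hσ⟩ := EnvyFreeSubsidy.exists_division hcard (by simpa using hn2)
    (v := fun i S => v i (S.map e.symm.toEmbedding)) fun i S a => by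
      simpa [Finset.map_insert] using hv i (S.map e.symm.toEmbedding) (e.symm a)
  let b : Fin n ≃ (Fin ν → ZMod p) := Fintype.equivOfCardEq hcard
  let B : Fin n → Finset α := fun j => {x | σ (e x) = b j}
  have hB (j : Fin n) :
      (Finset.univ.filter fun a => σ a = b j).map e.symm.toEmbedding = B j := by
    ext x
    simp only [Finset.mem_map_equiv, Finset.mem_filter_univ, Equiv.symm_symm, B]
  obtain ⟨π, q, hq0, hqE, hq⟩ := EnvyFreeSubsidy.exists_perm_payments (w := fun i j => v i (B j))
    (E := 13 * Real.sqrt (n * Real.log n)) fun i j j' => by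
      simpa [hB] using hσ i (b j) (b j')
  refine ⟨fun i => B (π i), q, fun i j hij => ?_, fun x => ?_, hq0, hq, ?_⟩
  · refine Finset.disjoint_left.mpr fun x hx hx' => hij ?_
    simp only [B, Finset.mem_filter_univ] at hx hx'
    exact π.injective (b.injective (hx.symm.trans hx'))
  · exact ⟨π.symm (b.symm (σ (e x))), by simp [B]⟩
  · refine (Finset.sum_le_sum fun i _ => hqE i).trans_eq ?_
    rw [Finset.sum_const, Finset.card_univ, Fintype.card_fin, nsmul_eq_mul]
    ring
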